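/- arXiv:2505.05185 — 4 statements merged into one kernel-verified Lean document; each statement's English description precedes it below -/
import Mathlib

section
/- Let G=(V,E) be a connected undirected graph, let β ∈ (1,∞)^E and λ ∈ (0,1)^V, and set p_e = 1 − 1/β_e for each e ∈ E. Then for every T ⊆ V, μ^Ising_{β,λ}(T) = Σ_{S⊆E} μ^RC_{E,p,λ}(S)·q(S,T), where q(S,T) = 0 unless every connected component C of the graph (V,S) satisfies C ⊆ T or C ∩ T = ∅, and in the latter case q(S,T) = (∏_{C∈κ(V,S), C⊆T} (∏_{u∈C} λ_u)/(1+∏_{u∈C} λ_u)) · (∏_{C∈κ(V,S), C∩T=∅} 1/(1+∏_{u∈C} λ_u)). In other words, sampling S from the random cluster distribution and then independently including each connected component C of (V,S) in X with probability (∏_{u∈C} λ_u)/(1+∏_{u∈C} λ_u) produces a sample X distributed exactly as μ^Ising_{β,λ}. -/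
open Finset Real

open scoped Classical in
/-- Vertices `u,v` are adjacent via an edge of `S` (edge `e` has endpoints `ends e`). -/
def adjRel {V E : Type} (ends : E → V × V) (S : Finset E) (u v : V) : Prop :=
  ∃ e ∈ S, ends e = (u, v) ∨ ends e = (v, u)

open scoped Classical in
/-- The connected component of `v` in the graph `(V, S)`. -/
noncomputable def comp {V E : Type} [Fintype V] (ends : E → V × V) (S : Finset E) (v : V) :
    Finset V :=
  Finset.univ.filter (fun u => Relation.ReflTransGen (adjRel ends S) v u)

/-- The set of connected components of the graph `(V, S)`. -/
noncomputable def comps {V E : Type} [Fintype V] [DecidableEq V] (ends : E → V × V) (S : Finset E) :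
    Finset (Finset V) :=
  Finset.univ.image (comp ends S)

/-- The random cluster weight of `S ⊆ U` w.r.t. the graph `(V, U)`. -/
noncomputable def rcWeight {V E : Type} [Fintype V] [DecidableEq V] [DecidableEq E]
    (ends : E → V × V) (p : E → ℝ) (lam : V → ℝ) (U S : Finset E) : ℝ :=
  (∏ e ∈ S, p e) * (∏ e ∈ U \ S, (1 - p e)) * ∏ C ∈ comps ends S, (1 + ∏ v ∈ C, lam v)

/-- The random cluster distribution `μ^RC_{U,p,λ}` on subsets of `U`, w.r.t. the graph `(V, U)`. -/
noncomputable def rcProb {V E : Type} [Fintype V] [DecidableEq V] [DecidableEq E]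
    (ends : E → V × V) (p : E → ℝ) (lam : V → ℝ) (U S : Finset E) : ℝ :=
  if S ⊆ U then rcWeight ends p lam U S / ∑ T ∈ U.powerset, rcWeight ends p lam U T else 0

open scoped Classical in
/-- The Ising weight of `T ⊆ V`: product of `β_e` over monochromatic edges times
product of `λ_v` over `v ∈ T`. -/
noncomputable def isingWeight {V E : Type} [Fintype E] [DecidableEq V]
    (ends : E → V × V) (β : E → ℝ) (lam : V → ℝ) (T : Finset V) : ℝ :=
  (∏ e ∈ Finset.univ.filter (fun e : E => ((ends e).1 ∈ T ↔ (ends e).2 ∈ T)), β e) *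
    ∏ v ∈ T, lam v

/-- The Ising Gibbs distribution `μ^Ising_{β,λ}` on subsets of `V`. -/
noncomputable def isingProb {V E : Type} [Fintype V] [Fintype E] [DecidableEq V]
    (ends : E → V × V) (β : E → ℝ) (lam : V → ℝ) (T : Finset V) : ℝ :=
  isingWeight ends β lam T / ∑ T' : Finset V, isingWeight ends β lam T'

/-- The graph with edge endpoints `ends` is connected. -/
def GraphConnected {V E : Type} [Fintype E] (ends : E → V × V) : Prop :=
  ∀ u v : V, Relation.ReflTransGen (adjRel ends Finset.univ) u v

open scoped Classical in
/-- The Edwards–Sokal kernel `q(S,T)`: zero unless every connected component of `(V,S)` is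
contained in `T` or disjoint from `T`; otherwise the product of
`(∏_{u∈C} λ_u)/(1+∏_{u∈C} λ_u)` over components inside `T` and `1/(1+∏_{u∈C} λ_u)` over
components disjoint from `T`. -/
noncomputable def esKernel {V E : Type} [Fintype V] [DecidableEq V]
    (ends : E → V × V) (lam : V → ℝ) (S : Finset E) (T : Finset V) : ℝ :=
  if ∀ C ∈ comps ends S, C ⊆ T ∨ C ∩ T = ∅ then
    (∏ C ∈ (comps ends S).filter (fun C => C ⊆ T),
        (∏ u ∈ C, lam u) / (1 + ∏ u ∈ C, lam u)) *
      ∏ C ∈ (comps ends S).filter (fun C => C ∩ T = ∅), 1 / (1 + ∏ u ∈ C, lam u)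
  else 0

open scoped Classical in
lemma es_mem_comp {V E : Type} [Fintype V] (ends : E → V × V) (S : Finset E) (v u : V) :
    u ∈ comp ends S v ↔ Relation.ReflTransGen (adjRel ends S) v u := by
  simp [comp]

lemma es_symm {V E : Type} (ends : E → V × V) (S : Finset E) {u v : V}
    (h : Relation.ReflTransGen (adjRel ends S) u v) :
    Relation.ReflTransGen (adjRel ends S) v u := by
  have hs : Std.Symm (adjRel ends S) := ⟨by
    rintro a b ⟨e, he, h⟩
    exact ⟨e, he, h.symm⟩⟩
  induction h with
  | refl => exact .refl
  | tail _ hbc ih => exact .head (hs.symm _ _ hbc) ih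

lemma es_comp_eq {V E : Type} [Fintype V] (ends : E → V × V) (S : Finset E) {u v : V}
    (h : Relation.ReflTransGen (adjRel ends S) u v) : comp ends S u = comp ends S v := by
  ext x
  rw [es_mem_comp, es_mem_comp]
  exact ⟨fun hx => (es_symm ends S h).trans hx, fun hx => h.trans hx⟩

lemma es_self {V E : Type} [Fintype V] (ends : E → V × V) (S : Finset E) (v : V) :
    v ∈ comp ends S v := (es_mem_comp ends S v v).2 .refl

section
variable {V E : Type} [Fintype V] [DecidableEq V]

lemma es_eq_of_mem (ends : E → V × V) (S : Finset E) {C : Finset V}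
    (hC : C ∈ comps ends S) {x : V} (hx : x ∈ C) : C = comp ends S x := by
  obtain ⟨v, -, rfl⟩ := Finset.mem_image.1 hC
  exact es_comp_eq ends S ((es_mem_comp ends S v x).1 hx)

lemma es_comp_mem (ends : E → V × V) (S : Finset E) (v : V) : comp ends S v ∈ comps ends S :=
  Finset.mem_image_of_mem _ (Finset.mem_univ v)

lemma es_nonempty (ends : E → V × V) (S : Finset E) {C : Finset V}
    (hC : C ∈ comps ends S) : C.Nonempty := by
  obtain ⟨v, -, rfl⟩ := Finset.mem_image.1 hC
  exact ⟨v, es_self ends S v⟩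

lemma es_disj (ends : E → V × V) (S : Finset E) {A : Finset (Finset V)}
    (hA : A ⊆ comps ends S) : (A : Set (Finset V)).PairwiseDisjoint id := by
  intro C hC D hD hne
  refine Finset.disjoint_left.2 fun x hx hx' => hne ?_
  rw [es_eq_of_mem ends S (hA hC) hx, es_eq_of_mem ends S (hA hD) hx']

/-- Compatibility of an edge set with a vertex set. -/
def esCompat (ends : E → V × V) (S : Finset E) (T : Finset V) : Prop :=
  ∀ C ∈ comps ends S, C ⊆ T ∨ C ∩ T = ∅

lemma es_compat_iff (ends : E → V × V) (S : Finset E) (T : Finset V) :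
    esCompat ends S T ↔ ∀ e ∈ S, ((ends e).1 ∈ T ↔ (ends e).2 ∈ T) := by
  constructor
  · intro h e he
    have h1 : (ends e).2 ∈ comp ends S (ends e).1 :=
      (es_mem_comp _ _ _ _).2 (.single ⟨e, he, Or.inl rfl⟩)
    have h0 := es_self ends S (ends e).1
    rcases h _ (es_comp_mem ends S (ends e).1) with h | h
    · exact ⟨fun _ => h h1, fun _ => h h0⟩
    · have hn : ∀ x ∈ comp ends S (ends e).1, x ∉ T := fun x hx hxT => by
        have := Finset.mem_inter.2 ⟨hx, hxT⟩
        simp [h] at this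
      exact ⟨fun h => absurd h (hn _ h0), fun h => absurd h (hn _ h1)⟩
  · intro h C hC
    obtain ⟨v, -, rfl⟩ := Finset.mem_image.1 hC
    have key : ∀ x, Relation.ReflTransGen (adjRel ends S) v x → (v ∈ T ↔ x ∈ T) := by
      intro x hx
      induction hx with
      | refl => rfl
      | tail _ hbc ih =>
        obtain ⟨e, he, h' | h'⟩ := hbc
        · have := h e he
          rw [h'] at this
          exact ih.trans this
        · have := h e he
          rw [h'] at this
          exact ih.trans this.symm
    by_cases hv : v ∈ T
    · left
      intro x hx
      exact (key x ((es_mem_comp _ _ _ _).1 hx)).1 hv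
    · right
      refine Finset.eq_empty_of_forall_notMem fun x hx => hv ?_
      rw [Finset.mem_inter] at hx
      exact (key x ((es_mem_comp _ _ _ _).1 hx.1)).2 hx.2

lemma es_biUnion (ends : E → V × V) (S : Finset E) {T : Finset V} (h : esCompat ends S T) :
    ((comps ends S).filter (fun C => C ⊆ T)).biUnion id = T := by
  ext x
  simp only [Finset.mem_biUnion, Finset.mem_filter, id]
  constructor
  · rintro ⟨C, ⟨_, hCT⟩, hx⟩
    exact hCT hx
  · intro hx
    refine ⟨comp ends S x, ⟨es_comp_mem ends S x, ?_⟩, es_self ends S x⟩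
    refine (h _ (es_comp_mem ends S x)).resolve_right fun h0 => ?_
    have := Finset.mem_inter.2 ⟨es_self ends S x, hx⟩
    simp [h0] at this

lemma es_prod (ends : E → V × V) (S : Finset E) (lam : V → ℝ) {A : Finset (Finset V)}
    (hA : A ⊆ comps ends S) : ∏ v ∈ A.biUnion id, lam v = ∏ C ∈ A, ∏ v ∈ C, lam v :=
  Finset.prod_biUnion (es_disj ends S hA)

open scoped Classical in
lemma es_kernel (ends : E → V × V) (S : Finset E) (T : Finset V) (lam : V → ℝ)
    (hlam : ∀ v, 0 < lam v) :
    (∏ C ∈ comps ends S, (1 + ∏ v ∈ C, lam v)) * esKernel ends lam S T =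
      if esCompat ends S T then ∏ v ∈ T, lam v else 0 := by
  unfold esKernel
  by_cases h : esCompat ends S T
  · rw [if_pos h, if_pos (show ∀ C ∈ comps ends S, C ⊆ T ∨ C ∩ T = ∅ from h)]
    have hf : (comps ends S).filter (fun C => C ∩ T = ∅) =
        (comps ends S).filter (fun C => ¬ C ⊆ T) := by
      refine Finset.filter_congr fun C hC => ?_
      constructor
      · intro h0 h1
        rw [Finset.inter_eq_left.2 h1] at h0
        exact (es_nonempty ends S hC).ne_empty h0
      · exact fun h1 => (h C hC).resolve_left h1
    have hpos : ∀ C : Finset V, (1 + ∏ v ∈ C, lam v) ≠ 0 := fun C =>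
      (add_pos one_pos (Finset.prod_pos fun v _ => hlam v)).ne'
    conv_rhs => rw [← es_biUnion ends S h]
    rw [es_prod ends S lam (Finset.filter_subset _ _), hf,
      ← Finset.prod_filter_mul_prod_filter_not (comps ends S) (fun C => C ⊆ T)
        (fun C => 1 + ∏ v ∈ C, lam v), mul_mul_mul_comm, ← Finset.prod_mul_distrib,
      ← Finset.prod_mul_distrib]
    simp only [mul_div_cancel₀ _ (hpos _), mul_one_div_cancel (hpos _), Finset.prod_const_one,
      mul_one]
  · rw [if_neg h, if_neg (show ¬ ∀ C ∈ comps ends S, C ⊆ T ∨ C ∩ T = ∅ from h), mul_zero]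

open scoped Classical in
lemma es_sum_T (ends : E → V × V) (S : Finset E) (lam : V → ℝ) :
    ∑ T : Finset V, (if esCompat ends S T then ∏ v ∈ T, lam v else 0) =
      ∏ C ∈ comps ends S, (1 + ∏ v ∈ C, lam v) := by
  rw [Finset.prod_one_add, ← Finset.sum_filter]
  refine Finset.sum_bij' (fun T _ => (comps ends S).filter (fun C => C ⊆ T))
    (fun A _ => A.biUnion id) ?_ ?_ ?_ ?_ ?_
  · intro T _
    exact Finset.mem_powerset.2 (Finset.filter_subset _ _)
  · intro A hA
    rw [Finset.mem_powerset] at hA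
    refine Finset.mem_filter.2 ⟨Finset.mem_univ _, fun C hC => ?_⟩
    by_cases hCA : C ∈ A
    · exact Or.inl (Finset.subset_biUnion_of_mem id hCA)
    · right
      refine Finset.eq_empty_of_forall_notMem fun x hx => hCA ?_
      obtain ⟨hxC, hx⟩ := Finset.mem_inter.1 hx
      obtain ⟨D, hD, hxD⟩ := Finset.mem_biUnion.1 hx
      rwa [es_eq_of_mem ends S hC hxC, ← es_eq_of_mem ends S (hA hD) hxD]
  · intro T hT
    exact es_biUnion ends S (Finset.mem_filter.1 hT).2
  · intro A hA
    rw [Finset.mem_powerset] at hA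
    ext C
    rw [Finset.mem_filter]
    constructor
    · rintro ⟨hC, hsub⟩
      obtain ⟨x, hx⟩ := es_nonempty ends S hC
      obtain ⟨D, hD, hxD⟩ := Finset.mem_biUnion.1 (hsub hx)
      rwa [es_eq_of_mem ends S hC hx, ← es_eq_of_mem ends S (hA hD) hxD]
    · exact fun hC => ⟨hA hC, Finset.subset_biUnion_of_mem id hC⟩
  · intro T hT
    conv_lhs => rw [← es_biUnion ends S (Finset.mem_filter.1 hT).2]
    exact es_prod ends S lam (Finset.filter_subset _ _)

open scoped Classical in
lemma es_sum_S [Fintype E] [DecidableEq E] (ends : E → V × V) (T : Finset V) (lam : V → ℝ)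
    (β p : E → ℝ) (hβ : ∀ e, 1 < β e) (hp : ∀ e, p e = 1 - (β e)⁻¹) :
    ∑ S : Finset E, ((∏ e ∈ S, p e) * ∏ e ∈ Finset.univ \ S, (1 - p e)) *
      (if esCompat ends S T then ∏ v ∈ T, lam v else 0) =
      (∏ e, (β e)⁻¹) * isingWeight ends β lam T := by
  have h := Finset.prod_add (fun e => if ((ends e).1 ∈ T ↔ (ends e).2 ∈ T) then p e else 0)
    (fun e => 1 - p e) (Finset.univ : Finset E)
  rw [Finset.powerset_univ] at h
  unfold isingWeight
  rw [← mul_assoc, Finset.prod_filter, ← Finset.prod_mul_distrib]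
  have h2 : ∏ e, ((β e)⁻¹ * if ((ends e).1 ∈ T ↔ (ends e).2 ∈ T) then β e else 1) =
      ∏ e, ((if ((ends e).1 ∈ T ↔ (ends e).2 ∈ T) then p e else 0) + (1 - p e)) := by
    refine Finset.prod_congr rfl fun e _ => ?_
    have : β e ≠ 0 := by linarith [hβ e]
    split_ifs
    · simp [this]
    · simp [hp]
  rw [h2, h, Finset.sum_mul]
  refine Finset.sum_congr rfl fun S _ => ?_
  rw [Finset.prod_ite_zero]
  simp only [es_compat_iff]
  split_ifs <;> simp

end

/-- **Edwards–Sokal coupling.** For a connected graph with `β ∈ (1,∞)^E`, `λ ∈ (0,1)^V` and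
`p_e = 1 - 1/β_e`, sampling `S` from the random cluster distribution and then including each
connected component `C` of `(V,S)` independently with probability
`(∏_{u∈C} λ_u)/(1+∏_{u∈C} λ_u)` produces exactly the Ising Gibbs distribution `μ^Ising_{β,λ}`. -/
theorem edwards_sokal_coupling {V E : Type} [Fintype V] [DecidableEq V]
    [Fintype E] [DecidableEq E] [Nonempty V]
    (ends : E → V × V) (hconn : GraphConnected ends)
    (β : E → ℝ) (lam : V → ℝ)
    (hβ : ∀ e, 1 < β e) (hlam : ∀ v, lam v ∈ Set.Ioo (0 : ℝ) 1)
    (p : E → ℝ) (hp : ∀ e, p e = 1 - (β e)⁻¹) :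
    ∀ T : Finset V,
      isingProb ends β lam T =
        ∑ S : Finset E, rcProb ends p lam Finset.univ S * esKernel ends lam S T := by
  classical
  intro T
  have hl : ∀ v, 0 < lam v := fun v => (hlam v).1
  have hc : (∏ e, (β e)⁻¹) ≠ 0 :=
    Finset.prod_ne_zero_iff.2 fun e _ => inv_ne_zero (by linarith [hβ e])
  have hZ : ∑ S ∈ (Finset.univ : Finset E).powerset, rcWeight ends p lam Finset.univ S =
      (∏ e, (β e)⁻¹) * ∑ T' : Finset V, isingWeight ends β lam T' := by
    rw [Finset.mul_sum, Finset.powerset_univ]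
    simp only [← es_sum_S ends _ lam β p hβ hp]
    rw [Finset.sum_comm]
    refine Finset.sum_congr rfl fun S _ => ?_
    rw [← Finset.mul_sum, es_sum_T]
    rfl
  have hN : ∑ S : Finset E, rcWeight ends p lam Finset.univ S * esKernel ends lam S T =
      (∏ e, (β e)⁻¹) * isingWeight ends β lam T := by
    rw [← es_sum_S ends _ lam β p hβ hp]
    refine Finset.sum_congr rfl fun S _ => ?_
    rw [← es_kernel ends S T lam hl, ← mul_assoc]
    rfl
  simp only [rcProb, Finset.subset_univ, if_true, isingProb, div_mul_eq_mul_div]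
  rw [← Finset.sum_div, hN, hZ, mul_div_mul_left _ _ hc]
end

section
/- Let E be a finite nonempty ground set, let μ be a probability distribution on the subsets of E with full support, and let θ ∈ (0,1). Then μ is a stationary distribution of the field dynamics P^FD_θ, i.e., Σ_{X⊆E} μ(X)·P^FD_θ(X,Y) = μ(Y) for every Y ⊆ E. -/
open Finset

/-- The tilted distribution `(θ⁻¹ * μ)` conditioned on `{Y : Y ⊆ U}`: for `Y ⊆ U` it assigns
probability proportional to `θ^{-|Y|}·μ(Y)`, and `0` otherwise. -/
noncomputable def tiltCond {E : Type} [Fintype E] [DecidableEq E]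
    (θ : ℝ) (μ : Finset E → ℝ) (U Y : Finset E) : ℝ :=
  if Y ⊆ U then
    (θ ^ Y.card)⁻¹ * μ Y / ∑ T ∈ U.powerset, (θ ^ T.card)⁻¹ * μ T
  else 0

/-- The transition kernel of the field dynamics `P^FD_θ`: from `X`, form `S ⊆ E` by including
each element independently with probability `θ`, then move to a sample of `(θ⁻¹ * μ)`
conditioned on `{Y : Y ⊆ X ∪ S}`. -/
noncomputable def fieldDyn {E : Type} [Fintype E] [DecidableEq E]
    (θ : ℝ) (μ : Finset E → ℝ) (X Y : Finset E) : ℝ :=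
  ∑ S : Finset E,
    θ ^ S.card * (1 - θ) ^ (Finset.univ \ S).card * tiltCond θ μ (X ∪ S) Y

/-- The inner fibre sum over all `S` with `X ∪ S = U`. -/
theorem fibre_sum {E : Type} [Fintype E] [DecidableEq E] (θ : ℝ) (h0 : 0 < θ)
    (X U : Finset E) (h : X ⊆ U) :
    ∑ S : Finset E with X ∪ S = U, θ ^ S.card * (1 - θ) ^ (Finset.univ \ S).card
      = (θ ^ X.card)⁻¹ * (θ ^ U.card * (1 - θ) ^ (Finset.univ \ U).card) := by
  have h1 : ∑ A ∈ X.powerset, θ ^ A.card * (1 - θ) ^ (X.card - A.card) = 1 := by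
    rw [Finset.sum_pow_mul_eq_add_pow]; simp
  have h2 : ∑ S : Finset E with X ∪ S = U, θ ^ S.card * (1 - θ) ^ (Finset.univ \ S).card
      = ∑ A ∈ X.powerset, ((θ ^ X.card)⁻¹ * (θ ^ U.card * (1 - θ) ^ (Finset.univ \ U).card)) *
          (θ ^ A.card * (1 - θ) ^ (X.card - A.card)) := by
    symm
    refine Finset.sum_bij' (fun A _ => (U \ X) ∪ A) (fun S _ => S ∩ X) ?_ ?_ ?_ ?_ ?_
    · intro A hA
      simp only [Finset.mem_powerset, Finset.mem_filter, Finset.mem_univ, true_and] at *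
      ext x; have := @h x; have := @hA x; simp; tauto
    · intro S hS
      simp
    · intro A hA
      simp only [Finset.mem_powerset] at hA
      ext x; have := @h x; have := @hA x; simp; tauto
    · intro S hS
      simp only [Finset.mem_filter, Finset.mem_univ, true_and] at hS
      subst hS
      ext x; simp; tauto
    · intro A hA
      simp only [Finset.mem_powerset] at hA
      have hd : Disjoint (U \ X) A := by
        rw [Finset.disjoint_left]; intro x hx hxA
        exact (Finset.mem_sdiff.mp hx).2 (hA hxA)
      have c1 : ((U \ X) ∪ A).card + X.card = U.card + A.card := by
        rw [Finset.card_union_of_disjoint hd]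
        have := Finset.card_sdiff_add_card_eq_card h
        omega
      have hle := Finset.card_le_card hA
      have c2 : (Finset.univ \ ((U \ X) ∪ A)).card
          = (Finset.univ \ U).card + (X.card - A.card) := by
        have a1 := Finset.card_sdiff_add_card_eq_card (Finset.subset_univ ((U \ X) ∪ A))
        have a2 := Finset.card_sdiff_add_card_eq_card (Finset.subset_univ U)
        omega
      have c3 : θ ^ ((U \ X) ∪ A).card = (θ ^ X.card)⁻¹ * (θ ^ U.card * θ ^ A.card) := by
        rw [← pow_add, ← c1, pow_add]
        field_simp
      rw [c2, c3, pow_add]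
      ring
  rw [h2, ← Finset.mul_sum, h1, mul_one]

theorem sum_union {E : Type} [Fintype E] [DecidableEq E] (θ : ℝ) (h0 : 0 < θ)
    (X : Finset E) (g : Finset E → ℝ) :
    ∑ S : Finset E, θ ^ S.card * (1 - θ) ^ (Finset.univ \ S).card * g (X ∪ S)
      = ∑ U : Finset E, if X ⊆ U then
        (θ ^ X.card)⁻¹ * (θ ^ U.card * (1 - θ) ^ (Finset.univ \ U).card) * g U else 0 := by
  rw [← Finset.sum_fiberwise (s := Finset.univ) (g := fun S => X ∪ S)]
  refine Finset.sum_congr rfl fun U _ => ?_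
  split_ifs with h
  · rw [← fibre_sum θ h0 X U h, Finset.sum_mul]
    refine Finset.sum_congr rfl fun S hS => ?_
    rw [(Finset.mem_filter.mp hS).2]
  · refine Finset.sum_eq_zero fun S hS => ?_
    exact absurd ((Finset.mem_filter.mp hS).2 ▸ Finset.subset_union_left) h

/-- **Stationarity of the field dynamics.** If `μ` is a fully supported probability distribution
on the subsets of a finite nonempty ground set `E` and `θ ∈ (0,1)`, then `μ` is stationary for
the field dynamics `P^FD_θ`. -/
theorem fieldDyn_stationary {E : Type} [Fintype E] [DecidableEq E] [Nonempty E]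
    (μ : Finset E → ℝ) (hpos : ∀ S : Finset E, 0 < μ S)
    (hsum : ∑ S : Finset E, μ S = 1)
    (θ : ℝ) (hθ : θ ∈ Set.Ioo (0 : ℝ) 1) :
    ∀ Y : Finset E, ∑ X : Finset E, μ X * fieldDyn θ μ X Y = μ Y := by
  intro Y
  have h0 := hθ.1
  have key := sum_union θ h0 Y (fun _ => 1)
  have tot : ∑ S : Finset E, θ ^ S.card * (1 - θ) ^ (Finset.univ \ S).card * (1 : ℝ) = 1 := by
    have := Finset.sum_pow_mul_eq_add_pow θ (1 - θ) (Finset.univ : Finset E)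
    simp only [add_sub_cancel, one_pow, Finset.powerset_univ] at this
    refine Eq.trans ?_ this
    refine Finset.sum_congr rfl fun S _ => ?_
    rw [Finset.card_sdiff_of_subset (Finset.subset_univ S), mul_one]
  rw [tot] at key
  have e : ∀ X, fieldDyn θ μ X Y = _ := fun X => sum_union θ h0 X (fun U => tiltCond θ μ U Y)
  simp only [e, Finset.mul_sum]
  rw [Finset.sum_comm]
  refine Eq.trans ?_ ((congrArg (fun z => μ Y * z) key.symm).trans (mul_one (μ Y)))
  simp only [Finset.mul_sum]
  refine Finset.sum_congr rfl fun U _ => ?_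
  have hZ : 0 < ∑ T ∈ U.powerset, (θ ^ T.card)⁻¹ * μ T :=
    Finset.sum_pos (fun T _ => mul_pos (by positivity) (hpos T)) ⟨∅, by simp⟩
  have l : ∑ X : Finset E, μ X * (if X ⊆ U then
        (θ ^ X.card)⁻¹ * (θ ^ U.card * (1 - θ) ^ (Finset.univ \ U).card) * tiltCond θ μ U Y else 0)
      = (∑ T ∈ U.powerset, (θ ^ T.card)⁻¹ * μ T) *
        (θ ^ U.card * (1 - θ) ^ (Finset.univ \ U).card * tiltCond θ μ U Y) := by
    have hp : U.powerset = Finset.univ.filter (fun X => X ⊆ U) := by ext; simp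
    rw [hp, Finset.sum_filter, Finset.sum_mul]
    refine Finset.sum_congr rfl fun X _ => ?_
    split_ifs <;> ring
  rw [l]
  unfold tiltCond
  split_ifs with h
  · generalize (∑ T ∈ U.powerset, (θ ^ T.card)⁻¹ * μ T) = Z at hZ
    generalize (θ ^ Y.card)⁻¹ = a
    generalize θ ^ U.card * (1 - θ) ^ (Finset.univ \ U).card = w
    have hZ' := hZ.ne'
    field_simp
  · simp
end

section
/- Fix integers T^GD, T^PA ≥ 1 and fix any realization of the choices X' ⊆ E, e_1,…,e_{T^GD} ∈ E and R_1,…,R_{T^GD} ∈ [0,1] used by the parallel simulation. If the iterate vectors stabilize, i.e., Y^{T^PA}_i = Y^{T^PA−1}_i for all 1 ≤ i ≤ T^GD, then the output of the parallel simulation equals the final state of the Glauber dynamics driven by the same choices: X^ALG = X_{T^GD}, where X_0 := X' and, for 1 ≤ i ≤ T^GD, X_i := X_{i−1} ∪ {e_i} if R_i < μ_{e_i}^{X_{i−1}} and X_i := X_{i−1} ∖ {e_i} otherwise. -/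
open MeasureTheory Finset

/-- The marginal probability `μ_e^X = μ(X∪{e}) / (μ(X∪{e}) + μ(X\{e}))`. -/
noncomputable def marg {E : Type} [DecidableEq E] (μ : Finset E → ℝ) (X : Finset E) (e : E) : ℝ :=
  μ (insert e X) / (μ (insert e X) + μ (X.erase e))

/-- `pred es i f`: the largest `j < i` with `es j = f` (or `⊥` if none), i.e. `pred_i(f)`. -/
def pred {E : Type} [DecidableEq E] {T : ℕ} (es : Fin T → E) (i : Fin T) (f : E) :
    WithBot (Fin T) :=
  (Finset.univ.filter (fun j : Fin T => j < i ∧ es j = f)).max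

/-- `jlast es f`: the largest `j` with `es j = f` (or `⊥` if none), i.e. `j_f`. -/
def jlast {E : Type} [DecidableEq E] {T : ℕ} (es : Fin T → E) (f : E) : WithBot (Fin T) :=
  (Finset.univ.filter (fun j : Fin T => es j = f)).max

/-- The configuration `σ_i` built from the initial set `X'` and the previous-round values
`Yprev`:
`σ_i = {f : (pred_i(f) = ⊥ ∧ f ∈ X') ∨ (pred_i(f) = j ∧ Yprev j = 1)}`. -/
def sigmaConf {E : Type} [Fintype E] [DecidableEq E] {T : ℕ}
    (es : Fin T → E) (X' : E → Bool) (Yprev : Fin T → Bool) (i : Fin T) : Finset E :=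
  Finset.univ.filter
    (fun f => (WithBot.recBotCoe (X' f) (fun j => Yprev j) (pred es i f)) = true)

/-- The iterates `Y^t` of the parallel simulation:
`Y^0_i = 1[es i ∈ X']` and `Y^t_i = 1[R_i < μ_{e_i}^{σ^t_i}]` where `σ^t_i` is built from
`Y^{t-1}`. -/
noncomputable def Yiter {E : Type} [Fintype E] [DecidableEq E] {T : ℕ}
    (μ : Finset E → ℝ) (es : Fin T → E) (Rs : Fin T → ℝ) (X' : E → Bool) :
    ℕ → Fin T → Bool
  | 0 => fun i => X' (es i)
  | t + 1 => fun i =>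
      if Rs i < marg μ (sigmaConf es X' (Yiter μ es Rs X' t) i) (es i) then true else false

/-- The output `X^ALG` of the parallel simulation after `TPA` rounds. -/
noncomputable def XALG {E : Type} [Fintype E] [DecidableEq E] {T : ℕ}
    (μ : Finset E → ℝ) (es : Fin T → E) (Rs : Fin T → ℝ) (X' : E → Bool) (TPA : ℕ) :
    Finset E :=
  Finset.univ.filter
    (fun f =>
      (WithBot.recBotCoe (X' f) (fun j => Yiter μ es Rs X' TPA j) (jlast es f)) = true)

/-- The Glauber dynamics trajectory driven by the choices `es, Rs` from initial state `X0`: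
`X_{i+1} = X_i ∪ {e_i}` if `R_i < μ_{e_i}^{X_i}`, else `X_i ∖ {e_i}`. -/
noncomputable def glauber {E : Type} [DecidableEq E] {T : ℕ}
    (μ : Finset E → ℝ) (es : Fin T → E) (Rs : Fin T → ℝ) (X0 : Finset E) : ℕ → Finset E
  | 0 => X0
  | i + 1 =>
      if h : i < T then
        if Rs ⟨i, h⟩ < marg μ (glauber μ es Rs X0 i) (es ⟨i, h⟩) then
          insert (es ⟨i, h⟩) (glauber μ es Rs X0 i)
        else (glauber μ es Rs X0 i).erase (es ⟨i, h⟩)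
      else glauber μ es Rs X0 i

/-- The set `X' ⊆ E` encoded by the boolean function `g`. -/
def toSet {E : Type} [Fintype E] [DecidableEq E] (g : E → Bool) : Finset E :=
  Finset.univ.filter (fun f => g f = true)

/-- The probability measure governing the random choices of the parallel simulation:
`e_1,…,e_T` uniform in `E`, `R_1,…,R_T` uniform in `[0,1]`, and `X'` containing each `f ∈ E`
independently with probability `μ_f^E`; all independent. -/
noncomputable def simMeasure {E : Type} [Fintype E] [DecidableEq E] [MeasurableSpace E]
    (μ : Finset E → ℝ) (T : ℕ) :
    Measure ((Fin T → E) × (Fin T → ℝ) × (E → Bool)) :=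
  ∑ es : Fin T → E, ∑ g : E → Bool,
    ((Fintype.card E : ENNReal)⁻¹ ^ T *
        ENNReal.ofReal
          (∏ f : E, if g f then marg μ Finset.univ f else 1 - marg μ Finset.univ f)) •
      (Measure.pi (fun _ : Fin T => volume.restrict (Set.Icc (0 : ℝ) 1))).map
        (fun r => (es, r, g))

/-- The total variation distance between the laws of two random variables `X, Y` with values
in a finite type, under the measure `P`. -/
noncomputable def dTVrv {Ω α : Type} [MeasurableSpace Ω] [Fintype α]
    (P : Measure Ω) (X Y : Ω → α) : ℝ :=
  (1 / 2) * ∑ a : α, |(P (X ⁻¹' {a})).toReal - (P (Y ⁻¹' {a})).toReal|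

/-- The total variation distance between the law of a random variable `X` (under `P`) and a
distribution given by a density `ν` on a finite type. -/
noncomputable def dTVrvDist {Ω α : Type} [MeasurableSpace Ω] [Fintype α]
    (P : Measure Ω) (X : Ω → α) (ν : α → ℝ) : ℝ :=
  (1 / 2) * ∑ a : α, |(P (X ⁻¹' {a})).toReal - ν a|

/-- The coupling-with-stationary condition with parameter `η`: there is a good family `G` of
configurations such that (1) marginals contract in total variation between good configurations,
and (2) any random configuration whose coordinates are independently sampled with marginals of
the form `μ_f^{S(f)}` is good except with probability `η`. -/
def CouplingWithStationary {E : Type} [Fintype E] [DecidableEq E]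
    (μ : Finset E → ℝ) (η : ℝ) : Prop :=
  ∃ G : Finset (Finset E),
    (∀ X ∈ G, ∀ Y ∈ G,
        ∑ e : E, |marg μ X e - marg μ Y e| ≤ ((symmDiff X Y).card : ℝ) / 2) ∧
    (∀ S : E → Finset E,
        ∑ σ ∈ Finset.univ.filter (fun σ : Finset E => σ ∉ G),
            ∏ f : E, (if f ∈ σ then marg μ (S f) f else 1 - marg μ (S f) f) ≤ η)

/-- The configuration read off from `Y` after the first `k` updates. -/
def confAt {E : Type} [Fintype E] [DecidableEq E] {T : ℕ}
    (es : Fin T → E) (X' : E → Bool) (Y : Fin T → Bool) (k : ℕ) : Finset E :=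
  Finset.univ.filter
    (fun f => (WithBot.recBotCoe (X' f) (fun j => Y j)
      ((Finset.univ.filter (fun j : Fin T => j.val < k ∧ es j = f)).max)) = true)

lemma confAt_eq_glauber {E : Type} [Fintype E] [DecidableEq E] {T : ℕ}
    (μ : Finset E → ℝ) (es : Fin T → E) (Rs : Fin T → ℝ) (X' : E → Bool) (Y : Fin T → Bool)
    (hY : ∀ i, Y i = if Rs i < marg μ (sigmaConf es X' Y i) (es i) then true else false)
    (k : ℕ) (hk : k ≤ T) : confAt es X' Y k = glauber μ es Rs (toSet X') k := by
  induction k with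
  | zero =>
    ext f
    simp [confAt, glauber, toSet]
  | succ k ih =>
    have hkT : k < T := hk
    have ih' := ih hkT.le
    have hs : sigmaConf es X' Y ⟨k, hkT⟩ = confAt es X' Y k := by
      unfold sigmaConf confAt pred
      simp only [Fin.lt_def]
    have hYk := hY ⟨k, hkT⟩
    rw [hs, ih'] at hYk
    have hself : ∀ f, f = es ⟨k, hkT⟩ →
        (f ∈ confAt es X' Y (k + 1) ↔ Y ⟨k, hkT⟩ = true) := by
      intro f hf
      have hmax : (Finset.univ.filter (fun j : Fin T => j.val < k + 1 ∧ es j = f)).max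
          = ((⟨k, hkT⟩ : Fin T) : WithBot (Fin T)) := by
        apply le_antisymm
        · apply Finset.max_le
          intro j hj
          simp only [Finset.mem_filter, Finset.mem_univ, true_and] at hj
          rw [WithBot.coe_le_coe, Fin.le_def]
          exact Nat.lt_succ_iff.mp hj.1
        · apply Finset.le_max
          simp [hf]
      simp only [confAt, Finset.mem_filter, Finset.mem_univ, true_and, hmax, WithBot.recBotCoe_coe]
    have hne : ∀ f, f ≠ es ⟨k, hkT⟩ →
        (f ∈ confAt es X' Y (k + 1) ↔ f ∈ confAt es X' Y k) := by
      intro f hf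
      have hfil : (Finset.univ.filter (fun j : Fin T => j.val < k + 1 ∧ es j = f))
          = (Finset.univ.filter (fun j : Fin T => j.val < k ∧ es j = f)) := by
        ext j
        simp only [Finset.mem_filter, Finset.mem_univ, true_and]
        constructor
        · rintro ⟨h1, h2⟩
          refine ⟨lt_of_le_of_ne (Nat.lt_succ_iff.mp h1) ?_, h2⟩
          intro h3
          apply hf
          rw [← h2]
          congr 1
          exact Fin.ext h3
        · rintro ⟨h1, h2⟩
          exact ⟨by omega, h2⟩
      simp only [confAt, Finset.mem_filter, Finset.mem_univ, true_and, hfil]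
    ext f
    rw [glauber, dif_pos hkT]
    by_cases hf : f = es ⟨k, hkT⟩
    · rw [hself f hf, hYk]
      split_ifs <;> simp [hf]
    · rw [hne f hf, ih']
      split_ifs <;> simp [hf]

/-- **Stabilization implies faithfulness (deterministic).** Fix any realization of the choices
`X', e_1,…,e_{T^GD}, R_1,…,R_{T^GD}`. If `Y^{T^PA}_i = Y^{T^PA-1}_i` for all `i`, then the
output of the parallel simulation equals the final state of the Glauber dynamics driven by the
same choices. -/
theorem XALG_eq_glauber_of_stable {E : Type} [Fintype E] [DecidableEq E] [Nonempty E]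
    (μ : Finset E → ℝ) (hpos : ∀ S : Finset E, 0 < μ S)
    (hsum : ∑ S : Finset E, μ S = 1)
    (TGD TPA : ℕ) (hTGD : 1 ≤ TGD) (hTPA : 1 ≤ TPA)
    (es : Fin TGD → E) (Rs : Fin TGD → ℝ) (hRs : ∀ i, Rs i ∈ Set.Icc (0 : ℝ) 1)
    (X' : E → Bool)
    (hstable : ∀ i : Fin TGD, Yiter μ es Rs X' TPA i = Yiter μ es Rs X' (TPA - 1) i) :
    XALG μ es Rs X' TPA = glauber μ es Rs (toSet X') TGD := by
  obtain ⟨t, rfl⟩ : ∃ t, TPA = t + 1 := ⟨TPA - 1, by omega⟩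
  have hfun : Yiter μ es Rs X' (t + 1) = Yiter μ es Rs X' t := funext hstable
  rw [← confAt_eq_glauber μ es Rs X' (Yiter μ es Rs X' (t + 1)) ?_ TGD le_rfl]
  · unfold XALG confAt jlast
    simp only [Fin.is_lt, true_and]
  · intro i
    conv_rhs => rw [hfun]
    rfl
end

section
/- Let G = (V,E) be a connected undirected graph with n = |V| ≥ 3 vertices and m = |E| edges, let p ∈ (0,1)^E and λ ∈ [0,1)^V, let ε ∈ (0,1/2], and suppose (1 − p_min)·log n ≤ min{e^{−40}·exp(−5·log(1/ε)/log n), (1 − λ_max)/27}. Then for any integers T^GD ≥ ⌈2m·(log m + log(4/ε))⌉ and T^PA ≥ ⌈3·log(4·T^GD/ε)⌉, the output X^ALG of the parallel simulation applied to μ = μ^RC_{E,p,λ} satisfies d_TV(X^ALG, μ) ≤ ε. -/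
open MeasureTheory Finset Real

open MeasureTheory Finset Real

/-! ### Components -/
set_option linter.unusedSectionVars false

section comps
variable {V E : Type} [Fintype V] [DecidableEq V] [DecidableEq E] (ends : E → V × V)

lemma adjRel_symm {S : Finset E} {u v : V} (h : adjRel ends S u v) : adjRel ends S v u := by
  obtain ⟨e, he, h⟩ := h
  exact ⟨e, he, h.symm⟩

lemma mem_comp {S : Finset E} {u v : V} :
    u ∈ comp ends S v ↔ Relation.ReflTransGen (adjRel ends S) v u := by
  simp [comp]

lemma self_mem_comp (S : Finset E) (v : V) : v ∈ comp ends S v :=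
  (mem_comp ends).2 Relation.ReflTransGen.refl

lemma comp_trans {S : Finset E} {u v w : V} (h : v ∈ comp ends S u) (h' : w ∈ comp ends S v) :
    w ∈ comp ends S u := by
  rw [mem_comp] at *
  exact h.trans h'

lemma comp_symm {S : Finset E} {u v : V} (h : v ∈ comp ends S u) : u ∈ comp ends S v := by
  rw [mem_comp] at *
  induction h with
  | refl => exact Relation.ReflTransGen.refl
  | tail hab hbc ih => exact Relation.ReflTransGen.head (adjRel_symm ends hbc) ih

lemma comp_eq_of_mem {S : Finset E} {u v : V} (h : v ∈ comp ends S u) :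
    comp ends S v = comp ends S u := by
  ext w
  exact ⟨fun h' => comp_trans ends h h', fun h' => comp_trans ends (comp_symm ends h) h'⟩

lemma comp_eq_iff {S : Finset E} {u v : V} :
    comp ends S v = comp ends S u ↔ v ∈ comp ends S u :=
  ⟨fun h => h ▸ self_mem_comp ends S v, comp_eq_of_mem ends⟩

lemma comp_mono {S S' : Finset E} (h : S ⊆ S') (v : V) : comp ends S v ⊆ comp ends S' v := by
  intro w hw
  rw [mem_comp] at *
  exact Relation.ReflTransGen.mono (fun a b ⟨e, he, h'⟩ => ⟨e, h he, h'⟩) _ _ hw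

lemma comp_step {S : Finset E} {e : E} (he : e ∈ S) {w : V}
    (h : (ends e).1 ∈ comp ends S w) : (ends e).2 ∈ comp ends S w := by
  rw [mem_comp] at *
  exact h.tail ⟨e, he, Or.inl rfl⟩

lemma comp_step' {S : Finset E} {e : E} (he : e ∈ S) {w : V}
    (h : (ends e).2 ∈ comp ends S w) : (ends e).1 ∈ comp ends S w := by
  rw [mem_comp] at *
  exact h.tail ⟨e, he, Or.inr rfl⟩

lemma mem_comp_insert {S : Finset E} {e : E} {z z' : V} :
    z' ∈ comp ends (insert e S) z ↔ z' ∈ comp ends S z ∨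
      ((ends e).1 ∈ comp ends S z ∧ z' ∈ comp ends S (ends e).2) ∨
      ((ends e).2 ∈ comp ends S z ∧ z' ∈ comp ends S (ends e).1) := by
  constructor
  · intro h
    rw [mem_comp] at h
    induction h with
    | refl => exact Or.inl (self_mem_comp ends S z)
    | @tail b c hb hbc ih =>
      obtain ⟨e', he', h⟩ := hbc
      rcases Finset.mem_insert.1 he' with rfl | heS
      · have hs := self_mem_comp ends S
        rcases h with h | h
        · rw [h] at ih ⊢
          simp only at ih ⊢
          rcases ih with ih | ⟨h1, h2⟩ | ⟨h1, h2⟩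
          · exact Or.inr (Or.inl ⟨ih, hs _⟩)
          · exact Or.inr (Or.inl ⟨h1, hs _⟩)
          · exact Or.inl h1
        · rw [h] at ih ⊢
          simp only at ih ⊢
          rcases ih with ih | ⟨h1, h2⟩ | ⟨h1, h2⟩
          · exact Or.inr (Or.inr ⟨ih, hs _⟩)
          · exact Or.inl h1
          · exact Or.inr (Or.inr ⟨h1, hs _⟩)
      · have hbc : c ∈ comp ends S b :=
          (mem_comp ends).2 (Relation.ReflTransGen.single ⟨e', heS, h⟩)
        rcases ih with ih | ⟨h1, h2⟩ | ⟨h1, h2⟩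
        · exact Or.inl (comp_trans ends ih hbc)
        · exact Or.inr (Or.inl ⟨h1, comp_trans ends h2 hbc⟩)
        · exact Or.inr (Or.inr ⟨h1, comp_trans ends h2 hbc⟩)
  · have hm : ∀ z, comp ends S z ⊆ comp ends (insert e S) z :=
      comp_mono ends (Finset.subset_insert e S)
    rintro (h | ⟨h1, h2⟩ | ⟨h1, h2⟩)
    · exact hm _ h
    · exact comp_trans ends (comp_step ends (Finset.mem_insert_self e S) (hm _ h1)) (hm _ h2)
    · exact comp_trans ends (comp_step' ends (Finset.mem_insert_self e S) (hm _ h1)) (hm _ h2)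

/-- the product of the weights on a set -/
noncomputable def LL (lam : V → ℝ) (C : Finset V) : ℝ := ∏ v ∈ C, lam v

noncomputable def RR (lam : V → ℝ) (S : Finset E) : ℝ :=
  ∏ C ∈ comps ends S, (1 + ∏ v ∈ C, lam v)

lemma comp_insert_same {S : Finset E} {e : E} (h : (ends e).2 ∈ comp ends S (ends e).1) (z : V) :
    comp ends (insert e S) z = comp ends S z := by
  ext z'
  rw [mem_comp_insert]
  constructor
  · rintro (h' | ⟨h1, h2⟩ | ⟨h1, h2⟩)
    · exact h'
    · exact comp_trans ends h1 (comp_trans ends h h2)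
    · exact comp_trans ends h1 (comp_trans ends (comp_symm ends h) h2)
  · exact Or.inl

lemma comp_insert_left {S : Finset E} {e : E} {z : V} (h : (ends e).1 ∈ comp ends S z) :
    comp ends (insert e S) z = comp ends S (ends e).1 ∪ comp ends S (ends e).2 := by
  ext z'
  rw [mem_comp_insert, Finset.mem_union, ← comp_eq_of_mem ends h]
  constructor
  · rintro (h' | ⟨h1, h2⟩ | ⟨h1, h2⟩)
    · exact Or.inl h'
    · exact Or.inr h2
    · exact Or.inl h2
  · rintro (h' | h')
    · exact Or.inl h'
    · exact Or.inr (Or.inl ⟨self_mem_comp _ _ _, h'⟩)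

lemma comp_insert_right {S : Finset E} {e : E} {z : V} (h : (ends e).2 ∈ comp ends S z) :
    comp ends (insert e S) z = comp ends S (ends e).1 ∪ comp ends S (ends e).2 := by
  ext z'
  rw [mem_comp_insert, Finset.mem_union, ← comp_eq_of_mem ends h]
  constructor
  · rintro (h' | ⟨h1, h2⟩ | ⟨h1, h2⟩)
    · exact Or.inr h'
    · exact Or.inr h2
    · exact Or.inl h2
  · rintro (h' | h')
    · exact Or.inr (Or.inr ⟨self_mem_comp _ _ _, h'⟩)
    · exact Or.inl h'

lemma comp_insert_other {S : Finset E} {e : E} {z : V} (h : (ends e).1 ∉ comp ends S z)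
    (h' : (ends e).2 ∉ comp ends S z) :
    comp ends (insert e S) z = comp ends S z := by
  ext z'
  rw [mem_comp_insert]
  tauto

lemma comp_disjoint {S : Finset E} {x y : V} (h : y ∉ comp ends S x) :
    Disjoint (comp ends S x) (comp ends S y) := by
  rw [Finset.disjoint_left]
  intro z hz hz'
  exact h (comp_trans ends hz (comp_symm ends hz'))

lemma RR_insert_same (lam : V → ℝ) {S : Finset E} {e : E}
    (h : (ends e).2 ∈ comp ends S (ends e).1) :
    RR ends lam (insert e S) = RR ends lam S := by
  have : comp ends (insert e S) = comp ends S := funext (comp_insert_same ends h)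
  simp [RR, comps, this]

lemma RR_insert_diff (lam : V → ℝ) {S : Finset E} {e : E}
    (h : (ends e).2 ∉ comp ends S (ends e).1) :
    ∃ Q : ℝ, RR ends lam S = Q * ((1 + LL lam (comp ends S (ends e).1)) *
        (1 + LL lam (comp ends S (ends e).2))) ∧
      RR ends lam (insert e S) = Q * (1 + LL lam (comp ends S (ends e).1) *
        LL lam (comp ends S (ends e).2)) := by
  set A := comp ends S (ends e).1 with hA
  set B := comp ends S (ends e).2 with hB
  have hAB : Disjoint A B := comp_disjoint ends h
  have hne : A ≠ B := by
    intro hab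
    exact h (by rw [hab]; exact self_mem_comp _ _ _)
  set K := ((comps ends S).erase A).erase B with hK
  refine ⟨∏ C ∈ K, (1 + ∏ v ∈ C, lam v), ?_, ?_⟩
  · have hAm : A ∈ comps ends S := Finset.mem_image_of_mem _ (Finset.mem_univ _)
    have hBm : B ∈ (comps ends S).erase A :=
      Finset.mem_erase.2 ⟨hne.symm, Finset.mem_image_of_mem _ (Finset.mem_univ _)⟩
    rw [RR, ← Finset.mul_prod_erase _ _ hAm, ← Finset.mul_prod_erase _ _ hBm]
    simp only [LL]
    ring
  · have hcomps : comps ends (insert e S) = insert (A ∪ B) K := by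
      ext C
      simp only [comps, Finset.mem_image, Finset.mem_univ, true_and, Finset.mem_insert, hK,
        Finset.mem_erase]
      constructor
      · rintro ⟨z, rfl⟩
        by_cases h1 : (ends e).1 ∈ comp ends S z
        · exact Or.inl (comp_insert_left ends h1)
        by_cases h2 : (ends e).2 ∈ comp ends S z
        · exact Or.inl (comp_insert_right ends h2)
        rw [comp_insert_other ends h1 h2]
        refine Or.inr ⟨?_, ?_, z, rfl⟩
        · intro h'; apply h2; rw [h']; exact self_mem_comp _ _ _
        · intro h'; apply h1; rw [h']; exact self_mem_comp _ _ _
      · rintro (rfl | ⟨h1, h2, z, rfl⟩)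
        · exact ⟨(ends e).1, comp_insert_left ends (self_mem_comp _ _ _)⟩
        · refine ⟨z, comp_insert_other ends ?_ ?_⟩
          · intro h'; exact h2 (comp_eq_of_mem ends h').symm
          · intro h'; exact h1 (comp_eq_of_mem ends h').symm
    have hnot : A ∪ B ∉ K := by
      intro hmem
      simp only [hK, Finset.mem_erase, comps, Finset.mem_image, Finset.mem_univ, true_and] at hmem
      obtain ⟨h1, h2, z, hz⟩ := hmem
      have : (ends e).1 ∈ comp ends S z := by
        rw [hz]; exact Finset.mem_union_left _ (self_mem_comp _ _ _)
      exact h2 (hz ▸ (comp_eq_of_mem ends this).symm)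
    rw [RR, hcomps, Finset.prod_insert hnot, Finset.prod_union hAB]
    simp only [LL]
    ring

end comps

open MeasureTheory Finset Real
set_option linter.unusedSectionVars false

section theta
variable {V E : Type} [Fintype V] [DecidableEq V] [DecidableEq E] (ends : E → V × V)

/-- the interaction `(a+b)/(1+ab)` of the two components joined by `e`. -/
noncomputable def theta (lam : V → ℝ) (X : Finset E) (e : E) : ℝ :=
  if (ends e).2 ∈ comp ends (X.erase e) (ends e).1 then 0 else
    (LL lam (comp ends (X.erase e) (ends e).1) + LL lam (comp ends (X.erase e) (ends e).2)) /
    (1 + LL lam (comp ends (X.erase e) (ends e).1) * LL lam (comp ends (X.erase e) (ends e).2))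

variable {lam : V → ℝ} (hlam : ∀ v, lam v ∈ Set.Ico (0 : ℝ) 1)
include hlam

lemma LL_nonneg (C : Finset V) : 0 ≤ LL lam C := Finset.prod_nonneg fun v _ => (hlam v).1

lemma LL_le_one (C : Finset V) : LL lam C ≤ 1 :=
  Finset.prod_le_one (fun v _ => (hlam v).1) (fun v _ => (hlam v).2.le)

lemma LL_anti {C D : Finset V} (h : C ⊆ D) : LL lam D ≤ LL lam C := by
  unfold LL
  rw [← Finset.prod_sdiff h]
  exact mul_le_of_le_one_left (LL_nonneg hlam C) (LL_le_one hlam (D \ C))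

lemma LL_le_pow {L : ℝ} (hL : ∀ v, lam v ≤ L) (C : Finset V) : LL lam C ≤ L ^ C.card := by
  unfold LL
  calc ∏ v ∈ C, lam v ≤ ∏ v ∈ C, L := Finset.prod_le_prod (fun v _ => (hlam v).1) (fun v _ => hL v)
    _ = L ^ C.card := by simp

omit hlam in
lemma frac_mono {a b a' b' : ℝ} (ha' : 0 ≤ a') (haa : a' ≤ a) (ha : a ≤ 1) (hb' : 0 ≤ b')
    (hbb : b' ≤ b) (hb : b ≤ 1) : (a' + b') / (1 + a' * b') ≤ (a + b) / (1 + a * b) := by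
  have ha0 : 0 ≤ a := ha'.trans haa
  have hb0 : 0 ≤ b := hb'.trans hbb
  have h1 : 0 ≤ a' * b' := by positivity
  have h2 : 0 ≤ a * b := by positivity
  have h3 : 0 ≤ a * b' := by positivity
  have s1 : (a' + b') / (1 + a' * b') ≤ (a + b') / (1 + a * b') := by
    rw [div_le_div_iff₀ (by linarith) (by linarith)]
    nlinarith [mul_nonneg (sub_nonneg.2 haa) (show 0 ≤ 1 - b' * b' by nlinarith)]
  have s2 : (a + b') / (1 + a * b') ≤ (a + b) / (1 + a * b) := by
    rw [div_le_div_iff₀ (by linarith) (by linarith)]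
    nlinarith [mul_nonneg (sub_nonneg.2 hbb) (show 0 ≤ 1 - a * a by nlinarith)]
  exact s1.trans s2

omit hlam in
lemma frac_le_add {a b : ℝ} (ha : 0 ≤ a) (hb : 0 ≤ b) : (a + b) / (1 + a * b) ≤ a + b := by
  apply div_le_self (by positivity)
  have : 0 ≤ a * b := by positivity
  linarith

omit hlam in
lemma frac_diff {a b a' : ℝ} (ha' : 0 ≤ a') (haa : a' ≤ a) (hb : 0 ≤ b) (hb1 : b ≤ 1) :
    (a + b) / (1 + a * b) - (a' + b) / (1 + a' * b) ≤ a := by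
  have ha0 : 0 ≤ a := ha'.trans haa
  have h1 : 0 ≤ a' * b := by positivity
  have h2 : 0 ≤ a * b := by positivity
  have e1 : b ≤ (a' + b) / (1 + a' * b) := by
    rw [le_div_iff₀ (by linarith)]
    nlinarith [mul_nonneg ha' (show 0 ≤ 1 - b * b by nlinarith)]
  linarith [frac_le_add ha0 hb]

lemma theta_nonneg (X : Finset E) (e : E) : 0 ≤ theta ends lam X e := by
  unfold theta
  have := LL_nonneg hlam
  split_ifs
  · exact le_rfl
  · have h1 := this (comp ends (X.erase e) (ends e).1)
    have h2 := this (comp ends (X.erase e) (ends e).2)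
    positivity

lemma theta_anti {X Y : Finset E} (h : X ⊆ Y) (e : E) :
    theta ends lam Y e ≤ theta ends lam X e := by
  by_cases hY : (ends e).2 ∈ comp ends (Y.erase e) (ends e).1
  · have : theta ends lam Y e = 0 := by simp [theta, hY]
    rw [this]; exact theta_nonneg ends hlam X e
  · have hsub : X.erase e ⊆ Y.erase e := Finset.erase_subset_erase e h
    have hX : (ends e).2 ∉ comp ends (X.erase e) (ends e).1 :=
      fun h' => hY (comp_mono ends hsub _ h')
    simp only [theta, hX, hY, if_false]
    exact frac_mono (LL_nonneg hlam _) (LL_anti hlam (comp_mono ends hsub _)) (LL_le_one hlam _)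
      (LL_nonneg hlam _) (LL_anti hlam (comp_mono ends hsub _)) (LL_le_one hlam _)

lemma theta_le_one (X : Finset E) (e : E) : theta ends lam X e ≤ 1 := by
  unfold theta
  split_ifs
  · norm_num
  · have h1 := LL_nonneg hlam (comp ends (X.erase e) (ends e).1)
    have h2 := LL_nonneg hlam (comp ends (X.erase e) (ends e).2)
    have h1' := LL_le_one hlam (comp ends (X.erase e) (ends e).1)
    have h2' := LL_le_one hlam (comp ends (X.erase e) (ends e).2)
    rw [div_le_one (by positivity)]
    nlinarith

/-- the boundary indicator contribution -/
noncomputable def hh (lam : V → ℝ) (S : Finset E) (e : E) (w : V) : ℝ :=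
  if ((ends e).1 ∈ comp ends S w ↔ (ends e).2 ∉ comp ends S w) then LL lam (comp ends S w) else 0

lemma hh_nonneg (S : Finset E) (e : E) (w : V) : 0 ≤ hh ends lam S e w := by
  unfold hh
  split_ifs
  · exact LL_nonneg hlam _
  · exact le_rfl

omit hlam in
lemma hh_left {S : Finset E} {e : E} {w : V} (h : w ∈ comp ends S (ends e).1)
    (h' : (ends e).2 ∉ comp ends S (ends e).1) :
    hh ends lam S e w = LL lam (comp ends S (ends e).1) := by
  rw [hh, comp_eq_of_mem ends h, if_pos]
  simp [h', self_mem_comp]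

omit hlam in
lemma hh_right {S : Finset E} {e : E} {w : V} (h : w ∈ comp ends S (ends e).2)
    (h' : (ends e).2 ∉ comp ends S (ends e).1) :
    hh ends lam S e w = LL lam (comp ends S (ends e).2) := by
  rw [hh, comp_eq_of_mem ends h, if_pos]
  have : (ends e).1 ∉ comp ends S (ends e).2 := fun h1 => h' (comp_symm ends h1)
  simp [this, self_mem_comp]

lemma theta_diff {X : Finset E} {e f : E} (hef : e ≠ f) :
    theta ends lam X e - theta ends lam (insert f X) e ≤
      if (ends f).2 ∈ comp ends (X.erase e) (ends f).1 then 0 else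
        hh ends lam (X.erase e) e (ends f).1 + hh ends lam (X.erase e) e (ends f).2 := by
  have herase : (insert f X).erase e = insert f (X.erase e) :=
    Finset.erase_insert_of_ne hef.symm
  unfold theta
  rw [herase]
  set S := X.erase e
  set x := (ends e).1
  set y := (ends e).2
  split_ifs with h1 h2 h3 h4 h5 h6 h7
  · simp
  · simp only [sub_zero]; exact add_nonneg (hh_nonneg ends hlam _ _ _) (hh_nonneg ends hlam _ _ _)
  · exact absurd (comp_mono ends (Finset.subset_insert f S) _ h1) (by assumption)
  · exact absurd (comp_mono ends (Finset.subset_insert f S) _ h1) (by assumption)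
  · rw [comp_insert_same ends h6] at h5; exact absurd h5 h1
  ·
    rw [mem_comp_insert] at h5
    have hL := LL_nonneg hlam
    rcases h5 with h5 | ⟨h5, h7⟩ | ⟨h5, h7⟩
    · exact absurd h5 h1
    · rw [hh_left ends h5 h1, hh_right ends (comp_symm ends h7) h1]
      simpa using frac_le_add (hL _) (hL _)
    · rw [hh_left ends h5 h1, hh_right ends (comp_symm ends h7) h1]
      have := frac_le_add (hL (comp ends S x)) (hL (comp ends S y))
      linarith
  · rw [comp_insert_same ends h7, comp_insert_same ends h7]; simp
  · have hL := LL_nonneg hlam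
    have hn := hh_nonneg ends hlam S e
    have hsub : S ⊆ insert f S := Finset.subset_insert f S
    have key : ∀ w, (w = (ends f).1 ∨ w = (ends f).2) → w ∈ comp ends S x →
        (ends f).1 ∈ comp ends S y ∨ (ends f).2 ∈ comp ends S y → False := by
      rintro w hw hwx h
      apply h5
      rw [mem_comp_insert]
      rcases hw with rfl | rfl
      · rcases h with h | h
        · exact absurd (comp_trans ends hwx (comp_symm ends h)) h1
        · exact Or.inr (Or.inl ⟨hwx, comp_symm ends h⟩)
      · rcases h with h | h
        · exact Or.inr (Or.inr ⟨hwx, comp_symm ends h⟩)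
        · exact absurd (comp_trans ends hwx (comp_symm ends h)) h1
    by_cases hx : ∃ w, (w = (ends f).1 ∨ w = (ends f).2) ∧ w ∈ comp ends S x
    · obtain ⟨w, hw, hwx⟩ := hx
      have hy : comp ends (insert f S) y = comp ends S y := by
        apply comp_insert_other
        · exact fun h => key w hw hwx (Or.inl h)
        · exact fun h => key w hw hwx (Or.inr h)
      rw [hy]
      have := frac_diff (hL (comp ends (insert f S) x))
        (LL_anti hlam (comp_mono ends hsub x)) (hL (comp ends S y)) (LL_le_one hlam _)
      have h8 := hh_left (lam := lam) ends hwx h1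
      rcases hw with rfl | rfl
      · linarith [hn (ends f).2]
      · linarith [hn (ends f).1]
    · push Not at hx
      have hxx : comp ends (insert f S) x = comp ends S x := by
        apply comp_insert_other
        · exact hx _ (Or.inl rfl)
        · exact hx _ (Or.inr rfl)
      rw [hxx]
      by_cases hy : ∃ w, (w = (ends f).1 ∨ w = (ends f).2) ∧ w ∈ comp ends S y
      · obtain ⟨w, hw, hwy⟩ := hy
        have := frac_diff (hL (comp ends (insert f S) y))
          (LL_anti hlam (comp_mono ends hsub y)) (hL (comp ends S x)) (LL_le_one hlam _)
        have h8 := hh_right (lam := lam) ends hwy h1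
        rw [add_comm (LL lam (comp ends S x)), add_comm (LL lam (comp ends S x)),
          mul_comm (LL lam (comp ends S x)), mul_comm (LL lam (comp ends S x))]
        rcases hw with rfl | rfl
        · linarith [hn (ends f).2]
        · linarith [hn (ends f).1]
      · push Not at hy
        have hyy : comp ends (insert f S) y = comp ends S y := by
          apply comp_insert_other
          · exact hy _ (Or.inl rfl)
          · exact hy _ (Or.inr rfl)
        rw [hyy]
        linarith [hn (ends f).2, hn (ends f).1]

end theta

section bridges
variable {V E : Type} [Fintype V] [DecidableEq V] [DecidableEq E] (ends : E → V × V)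

/-- if some endpoint of `e'` is not reached in `X - e`, the component in `X - e` is contained in
that of `X - e'`. -/
lemma comp_erase_subset {X : Finset E} {e e' : E} {w y : V}
    (hy : y ∉ comp ends (X.erase e) w) (hye : y = (ends e').1 ∨ y = (ends e').2) :
    comp ends (X.erase e) w ⊆ comp ends (X.erase e') w := by
  intro z hz
  rw [mem_comp] at hz
  induction hz with
  | refl => exact self_mem_comp _ _ _
  | @tail b c hb hbc ih =>
    obtain ⟨g, hg, h⟩ := hbc
    have hbm : b ∈ comp ends (X.erase e) w := (mem_comp ends).2 hb
    have hcm : c ∈ comp ends (X.erase e) w := (mem_comp ends).2 (hb.tail ⟨g, hg, h⟩)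
    have hge : g ≠ e' := by
      rintro rfl
      rcases h with h | h <;> rw [h] at hye <;> rcases hye with rfl | rfl <;> simp_all
    exact comp_trans ends ih ((mem_comp ends).2 (Relation.ReflTransGen.single
      ⟨g, Finset.mem_erase.2 ⟨hge, Finset.mem_of_mem_erase hg⟩, h⟩))

/-- `e` is a bridge of `X` adjacent to the part of `w`. -/
def IsBr (X : Finset E) (w : V) (e : E) : Prop :=
  e ∈ X ∧ ((ends e).1 ∈ comp ends (X.erase e) w ↔ (ends e).2 ∉ comp ends (X.erase e) w)

open scoped Classical in
noncomputable def far (X : Finset E) (w : V) (e : E) : V :=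
  if (ends e).1 ∈ comp ends (X.erase e) w then (ends e).2 else (ends e).1

lemma far_not_mem {X : Finset E} {w : V} {e : E} (h : IsBr ends X w e) :
    far ends X w e ∉ comp ends (X.erase e) w := by
  unfold far
  split_ifs with h1
  · exact h.2.1 h1
  · exact h1

lemma far_end (X : Finset E) (w : V) (e : E) :
    far ends X w e = (ends e).1 ∨ far ends X w e = (ends e).2 := by
  unfold far
  split_ifs <;> simp

/-- if the `w`-part of `e` is included in the `w`-part of `e'`, then the far end of `e` is too. -/
lemma far_mem {X : Finset E} {w : V} {e e' : E} (h : IsBr ends X w e) (hne : e ≠ e')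
    (hsub : comp ends (X.erase e) w ⊆ comp ends (X.erase e') w) :
    far ends X w e ∈ comp ends (X.erase e') w := by
  have he : e ∈ X.erase e' := Finset.mem_erase.2 ⟨hne, h.1⟩
  unfold far
  split_ifs with h1
  · exact comp_step ends he (hsub h1)
  · have h2 : (ends e).2 ∈ comp ends (X.erase e) w := by
      by_contra h2
      exact h1 (h.2.2 h2)
    exact comp_step' ends he (hsub h2)

lemma bridge_card {X : Finset E} {w : V} {B : Finset E} (hB : ∀ e ∈ B, IsBr ends X w e)
    (hne : B.Nonempty) : ∃ e ∈ B, B.card ≤ (comp ends (X.erase e) w).card := by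
  obtain ⟨e, he, hmax⟩ := Finset.exists_max_image B (fun e => (comp ends (X.erase e) w).card) hne
  refine ⟨e, he, ?_⟩
  have hinj : Set.InjOn (far ends X w) (B.erase e : Finset E) := by
    intro e1 h1 e2 h2 h12
    by_contra hne
    have b1 := hB e1 (Finset.mem_of_mem_erase h1)
    have b2 := hB e2 (Finset.mem_of_mem_erase h2)
    have hs : comp ends (X.erase e1) w ⊆ comp ends (X.erase e2) w :=
      comp_erase_subset ends (far_not_mem ends b1) (by rw [h12]; exact far_end ends X w e2)
    have := far_mem ends b1 hne hs
    rw [h12] at this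
    exact far_not_mem ends b2 this
  have hmaps : ∀ e' ∈ B.erase e, far ends X w e' ∈ (comp ends (X.erase e) w).erase w := by
    intro e' he'
    have b' := hB e' (Finset.mem_of_mem_erase he')
    have b := hB e he
    have hne' : e ≠ e' := (Finset.ne_of_mem_erase he').symm
    rw [Finset.mem_erase]
    constructor
    · intro h
      apply far_not_mem ends b'
      rw [h]
      exact self_mem_comp _ _ _
    · by_contra hnot
      have hs := comp_erase_subset ends hnot (far_end ends X w e')
      have hf := far_mem ends b hne' hs
      have : (comp ends (X.erase e) w).card < (comp ends (X.erase e') w).card := by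
        apply Finset.card_lt_card
        rw [Finset.ssubset_iff_of_subset hs]
        exact ⟨_, hf, far_not_mem ends b⟩
      exact absurd (hmax e' (Finset.mem_of_mem_erase he')) (by simpa using this)
  have := Finset.card_le_card_of_injOn _ hmaps hinj
  rw [Finset.card_erase_of_mem he, Finset.card_erase_of_mem (self_mem_comp _ _ _)] at this
  have hpos : 0 < (comp ends (X.erase e) w).card := Finset.card_pos.2 ⟨w, self_mem_comp _ _ _⟩
  omega

lemma bridge_sum_aux {X : Finset E} {w : V} {L : ℝ} (hL0 : 0 ≤ L) (hL1 : L ≤ 1) (k : ℕ) :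
    ∀ B : Finset E, B.card = k → (∀ e ∈ B, IsBr ends X w e) →
    ∑ e ∈ B, L ^ (comp ends (X.erase e) w).card ≤ ∑ i ∈ Finset.range k, L ^ (i + 1) := by
  induction k with
  | zero =>
    intro B hB _
    rw [Finset.card_eq_zero] at hB
    simp [hB]
  | succ k ih =>
    intro B hB hBr
    have hne : B.Nonempty := Finset.card_pos.1 (by omega)
    obtain ⟨e, he, hc⟩ := bridge_card ends hBr hne
    rw [← Finset.add_sum_erase _ _ he, Finset.sum_range_succ, add_comm]
    apply add_le_add
    · exact ih _ (by rw [Finset.card_erase_of_mem he]; omega)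
        (fun e' he' => hBr e' (Finset.mem_of_mem_erase he'))
    · exact pow_le_pow_of_le_one hL0 hL1 (by omega)

lemma bridge_sum {X : Finset E} {w : V} {L : ℝ} (hL0 : 0 ≤ L) (hL1 : L < 1)
    (B : Finset E) (hB : ∀ e ∈ B, IsBr ends X w e) :
    ∑ e ∈ B, L ^ (comp ends (X.erase e) w).card ≤ 1 / (1 - L) := by
  refine (bridge_sum_aux ends hL0 hL1.le B.card B rfl hB).trans ?_
  have h1 : ∑ i ∈ Finset.range B.card, L ^ (i + 1) ≤ ∑ i ∈ Finset.range B.card, L ^ i :=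
    Finset.sum_le_sum fun i _ => pow_le_pow_of_le_one hL0 hL1.le (by omega)
  refine h1.trans ?_
  rw [geom_sum_eq hL1.ne, ← neg_div_neg_eq, neg_sub L 1, div_le_div_iff_of_pos_right]
  · have := pow_nonneg hL0 B.card
    linarith
  · linarith

end bridges

open MeasureTheory Finset Real
set_option linter.unusedSectionVars false

section margs
variable {V E : Type} [Fintype V] [DecidableEq V] [Fintype E] [DecidableEq E] (ends : E → V × V)
  {p : E → ℝ} {lam : V → ℝ}
  (hp : ∀ e, p e ∈ Set.Ioo (0 : ℝ) 1) (hlam : ∀ v, lam v ∈ Set.Ico (0 : ℝ) 1)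
include hp hlam

lemma rcWeight_pos (S : Finset E) : 0 < rcWeight ends p lam univ S := by
  unfold rcWeight
  refine mul_pos (mul_pos (Finset.prod_pos fun e _ => (hp e).1)
    (Finset.prod_pos fun e _ => by linarith [(hp e).2])) (Finset.prod_pos fun C _ => ?_)
  have := LL_nonneg hlam C
  unfold LL at this
  linarith

lemma rcSum_pos : 0 < ∑ T ∈ (univ : Finset E).powerset, rcWeight ends p lam univ T :=
  Finset.sum_pos (fun S _ => rcWeight_pos ends hp hlam S) ⟨∅, by simp⟩

lemma rcProb_pos (S : Finset E) : 0 < rcProb ends p lam univ S := by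
  rw [rcProb, if_pos (Finset.subset_univ S)]
  exact div_pos (rcWeight_pos ends hp hlam S) (rcSum_pos ends hp hlam)

lemma rcProb_sum : ∑ S : Finset E, rcProb ends p lam univ S = 1 := by
  have h := rcSum_pos ends hp hlam
  simp only [rcProb, Finset.subset_univ, if_true]
  rw [← Finset.sum_div, ← Finset.powerset_univ]
  exact div_self h.ne'

lemma marg_eq (X : Finset E) (e : E) :
    marg (rcProb ends p lam univ) X e = p e / (1 + (1 - p e) * theta ends lam X e) := by
  have hpe := hp e
  have hZ := rcSum_pos ends hp hlam
  have hins : insert e X = insert e (X.erase e) := by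
    ext i; by_cases hi : i = e <;> simp [hi]
  set S := X.erase e with hS
  have heS : e ∉ S := by simp [hS]
  have hth : theta ends lam X e = if (ends e).2 ∈ comp ends S (ends e).1 then 0 else
    (LL lam (comp ends S (ends e).1) + LL lam (comp ends S (ends e).2)) /
    (1 + LL lam (comp ends S (ends e).1) * LL lam (comp ends S (ends e).2)) := rfl
  have w1 : rcWeight ends p lam univ (insert e S) =
      p e * ((∏ i ∈ S, p i) * ∏ i ∈ univ \ (insert e S), (1 - p i)) * RR ends lam (insert e S) := by
    rw [rcWeight, Finset.prod_insert heS, RR]; ring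
  have hsd : univ \ S = insert e (univ \ insert e S) := by
    ext i
    by_cases hi : i = e
    · subst hi; simp [heS]
    · simp [hi]
  have w2 : rcWeight ends p lam univ S =
      (1 - p e) * ((∏ i ∈ S, p i) * ∏ i ∈ univ \ (insert e S), (1 - p i)) * RR ends lam S := by
    rw [rcWeight, hsd, Finset.prod_insert (by simp), RR]; ring
  have hA : 0 < (∏ i ∈ S, p i) * ∏ i ∈ univ \ (insert e S), (1 - p i) :=
    mul_pos (Finset.prod_pos fun e _ => (hp e).1)
      (Finset.prod_pos fun e _ => by linarith [(hp e).2])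
  have hRpos := rcWeight_pos ends hp hlam S
  rw [w2] at hRpos
  set A := (∏ i ∈ S, p i) * ∏ i ∈ univ \ (insert e S), (1 - p i)
  have hRS : 0 < RR ends lam S := by
    rcases lt_or_ge 0 (RR ends lam S) with h | h
    · exact h
    · have : 0 < (1 - p e) * A := mul_pos (by linarith [hpe.2]) hA
      nlinarith
  have hm : marg (rcProb ends p lam univ) X e =
      p e * RR ends lam (insert e S) /
        (p e * RR ends lam (insert e S) + (1 - p e) * RR ends lam S) := by
    rw [marg, ← hS, hins]
    simp only [rcProb, Finset.subset_univ, if_true]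
    rw [← add_div, div_div_div_cancel_right₀ hZ.ne', w1, w2]
    rw [show p e * A * RR ends lam (insert e S) = A * (p e * RR ends lam (insert e S)) by ring,
      show A * (p e * RR ends lam (insert e S)) + (1 - p e) * A * RR ends lam S =
        A * (p e * RR ends lam (insert e S) + (1 - p e) * RR ends lam S) by ring]
    rw [mul_div_mul_left _ _ hA.ne']
  rw [hm, hth]
  split_ifs with h
  · rw [RR_insert_same ends lam h]
    rw [← add_mul, mul_div_mul_right _ _ hRS.ne']
    simp
  · obtain ⟨Q, h1, h2⟩ := RR_insert_diff ends lam h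
    rw [h1] at hRS
    rw [h1, h2]
    have a0 := LL_nonneg hlam (comp ends S (ends e).1)
    have b0 := LL_nonneg hlam (comp ends S (ends e).2)
    set a := LL lam (comp ends S (ends e).1)
    set b := LL lam (comp ends S (ends e).2)
    have hQ : 0 < Q := by
      have : 0 < (1 + a) * (1 + b) := by positivity
      exact pos_of_mul_pos_left hRS this.le
    have hq : 0 < 1 - p e := by linarith [hpe.2]
    have hp0 := hpe.1
    have hab : 0 < 1 + a * b := by positivity
    have d1 : 0 < p e * (Q * (1 + a * b)) + (1 - p e) * (Q * ((1 + a) * (1 + b))) := by positivity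
    have d2 : 0 < 1 + (1 - p e) * ((a + b) / (1 + a * b)) := by positivity
    rw [div_eq_div_iff d1.ne' d2.ne']
    field_simp
    ring

lemma marg_diff {X Y : Finset E} (h : X ⊆ Y) (e : E) :
    0 ≤ marg (rcProb ends p lam univ) Y e - marg (rcProb ends p lam univ) X e ∧
    marg (rcProb ends p lam univ) Y e - marg (rcProb ends p lam univ) X e ≤
      (1 - p e) * (theta ends lam X e - theta ends lam Y e) := by
  rw [marg_eq ends hp hlam, marg_eq ends hp hlam]
  have h1 := theta_anti ends hlam h e
  have h0 := theta_nonneg ends hlam Y e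
  have h0' := theta_nonneg ends hlam X e
  obtain ⟨hp0, hp1⟩ := hp e
  set s := theta ends lam X e
  set t := theta ends lam Y e
  have hq : 0 < 1 - p e := by linarith
  have d1 : 1 ≤ 1 + (1 - p e) * t := by nlinarith
  have d2 : 1 ≤ 1 + (1 - p e) * s := by nlinarith
  have heq : p e / (1 + (1 - p e) * t) - p e / (1 + (1 - p e) * s) =
      p e * ((1 - p e) * (s - t)) / ((1 + (1 - p e) * t) * (1 + (1 - p e) * s)) := by
    rw [div_sub_div _ _ (by linarith) (by linarith)]
    congr 1
    ring
  rw [heq]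
  have hn : 0 ≤ (1 - p e) * (s - t) := mul_nonneg hq.le (by linarith)
  constructor
  · positivity
  · calc _ ≤ p e * ((1 - p e) * (s - t)) := by
          apply div_le_self (by positivity)
          nlinarith
      _ ≤ _ := by nlinarith

lemma marg_bounds {δ : ℝ} (hδ : ∀ e, 1 - p e ≤ δ) (X : Finset E) (e : E) :
    0 ≤ marg (rcProb ends p lam univ) X e ∧ marg (rcProb ends p lam univ) X e ≤ 1 ∧
    1 - marg (rcProb ends p lam univ) X e ≤ 2 * δ := by
  rw [marg_eq ends hp hlam]
  have h0 := theta_nonneg ends hlam X e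
  have h1 := theta_le_one ends hlam X e
  obtain ⟨hp0, hp1⟩ := hp e
  set s := theta ends lam X e
  have hq : 0 < 1 - p e := by linarith
  have d1 : 1 ≤ 1 + (1 - p e) * s := by nlinarith
  refine ⟨by positivity, ?_, ?_⟩
  · rw [div_le_one (by linarith)]; linarith
  · have : 1 - 2 * (1 - p e) ≤ p e / (1 + (1 - p e) * s) := by
      rw [le_div_iff₀ (by linarith)]
      nlinarith [mul_nonneg hq.le h0, mul_nonneg hq.le (sub_nonneg.2 h1)]
    linarith [hδ e]

end margs

section contraction
variable {V E : Type} [Fintype V] [DecidableEq V] [Fintype E] [DecidableEq E] (ends : E → V × V)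

/-- edge boundary of `C` -/
def bd (C : Finset V) : Finset E := univ.filter fun e => ((ends e).1 ∈ C ↔ (ends e).2 ∉ C)

noncomputable def wC (δ L : ℝ) (C : Finset V) : ℝ :=
  if 1 / 8 < δ * ((bd ends C).card * L ^ C.card) then δ * ((bd ends C).card * L ^ C.card) else 0

noncomputable def FF (δ L : ℝ) (X : Finset E) : ℝ :=
  ∑ C : Finset V, if Disjoint (bd ends C) X then wC ends δ L C else 0

lemma wC_nonneg (δ L : ℝ) (C : Finset V) : 0 ≤ wC ends δ L C := by
  unfold wC; split_ifs <;> linarith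

lemma le_wC (δ L : ℝ) (C : Finset V) :
    δ * ((bd ends C).card * L ^ C.card) ≤ 1 / 8 + wC ends δ L C := by
  unfold wC; split_ifs <;> linarith

lemma FF_nonneg (δ L : ℝ) (X : Finset E) : 0 ≤ FF ends δ L X :=
  Finset.sum_nonneg fun C _ => by
    split_ifs
    · exact wC_nonneg ends δ L C
    · exact le_rfl

lemma bd_comp_disjoint (X : Finset E) (w : V) : Disjoint (bd ends (comp ends X w)) X := by
  rw [Finset.disjoint_left]
  intro e he heX
  simp only [bd, Finset.mem_filter, Finset.mem_univ, true_and] at he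
  by_cases h : (ends e).1 ∈ comp ends X w
  · exact he.1 h (comp_step ends heX h)
  · exact h (he.2 fun h' => h (comp_step' ends heX h'))

lemma FF_anti (δ L : ℝ) {X Y : Finset E} (h : X ⊆ Y) : FF ends δ L Y ≤ FF ends δ L X := by
  apply Finset.sum_le_sum
  intro C _
  have hw := wC_nonneg ends δ L C
  by_cases n : Disjoint (bd ends C) Y
  · rw [if_pos n, if_pos (n.mono_right h)]
  · rw [if_neg n]; split_ifs <;> linarith

lemma FF_step (δ L : ℝ) {X : Finset E} {f : E}
    (h : (ends f).2 ∉ comp ends X (ends f).1) :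
    wC ends δ L (comp ends X (ends f).1) + wC ends δ L (comp ends X (ends f).2) ≤
      FF ends δ L X - FF ends δ L (insert f X) := by
  have h' : (ends f).1 ∉ comp ends X (ends f).2 := fun h1 => h (comp_symm ends h1)
  have hne : comp ends X (ends f).1 ≠ comp ends X (ends f).2 := by
    intro h1; rw [h1] at h; exact h (self_mem_comp _ _ _)
  have f1 : f ∈ bd ends (comp ends X (ends f).1) := by
    simp [bd, h, self_mem_comp]
  have f2 : f ∈ bd ends (comp ends X (ends f).2) := by
    simp [bd, h', self_mem_comp]
  unfold FF
  rw [← Finset.sum_sub_distrib]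
  have e1 : wC ends δ L (comp ends X (ends f).1) + wC ends δ L (comp ends X (ends f).2) =
      ∑ C : Finset V, ((if C = comp ends X (ends f).1 then wC ends δ L C else 0) +
        (if C = comp ends X (ends f).2 then wC ends δ L C else 0)) := by
    rw [Finset.sum_add_distrib]; simp
  rw [e1]
  apply Finset.sum_le_sum
  intro C _
  have hd := bd_comp_disjoint ends X
  have hw := wC_nonneg ends δ L C
  by_cases c1 : C = comp ends X (ends f).1
  · have c2 : C ≠ comp ends X (ends f).2 := c1 ▸ hne
    have n : ¬ Disjoint (bd ends C) (insert f X) := by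
      rw [Finset.not_disjoint_iff]; exact ⟨f, c1 ▸ f1, by simp⟩
    have y : Disjoint (bd ends C) X := c1 ▸ hd _
    rw [if_pos c1, if_neg c2, if_pos y, if_neg n]; linarith
  · by_cases c2 : C = comp ends X (ends f).2
    · have n : ¬ Disjoint (bd ends C) (insert f X) := by
        rw [Finset.not_disjoint_iff]; exact ⟨f, c2 ▸ f2, by simp⟩
      have y : Disjoint (bd ends C) X := c2 ▸ hd _
      rw [if_neg c1, if_pos c2, if_pos y, if_neg n]; linarith
    · rw [if_neg c1, if_neg c2]
      by_cases n : Disjoint (bd ends C) (insert f X)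
      · have y : Disjoint (bd ends C) X := n.mono_right (Finset.subset_insert f X)
        rw [if_pos y, if_pos n]; linarith
      · rw [if_neg n]; split_ifs <;> linarith

variable {p : E → ℝ} {lam : V → ℝ}
  (hp : ∀ e, p e ∈ Set.Ioo (0 : ℝ) 1) (hlam : ∀ v, lam v ∈ Set.Ico (0 : ℝ) 1)
  {δ L : ℝ} (hδ : ∀ e, 1 - p e ≤ δ) (hδ0 : 0 ≤ δ) (hL : ∀ v, lam v ≤ L) (hL0 : 0 ≤ L)
  (hL1 : L < 1) (hδL : δ * (2 / (1 - L)) ≤ 1 / 8)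

include hlam hL hL0 hL1 in
lemma hh_sum_in (X : Finset E) (w : V) :
    ∑ e ∈ X, hh ends lam (X.erase e) e w ≤ 1 / (1 - L) := by
  classical
  refine le_trans ?_ (bridge_sum ends (X := X) (w := w) hL0 hL1
    (X.filter fun e => IsBr ends X w e) (fun e he => (Finset.mem_filter.1 he).2))
  rw [Finset.sum_filter]
  apply Finset.sum_le_sum
  intro e he
  have : IsBr ends X w e ↔ ((ends e).1 ∈ comp ends (X.erase e) w ↔
      (ends e).2 ∉ comp ends (X.erase e) w) := by simp [IsBr, he]
  simp only [this, hh]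
  split_ifs
  · exact LL_le_pow hlam hL _
  · exact le_rfl

include hlam hL in
lemma hh_sum_out (X : Finset E) (w : V) :
    ∑ e ∈ univ \ X, hh ends lam (X.erase e) e w ≤
      (bd ends (comp ends X w)).card * L ^ (comp ends X w).card := by
  have h1 : ∑ e ∈ univ \ X, hh ends lam (X.erase e) e w = ∑ e ∈ univ \ X, hh ends lam X e w := by
    apply Finset.sum_congr rfl
    intro e he
    rw [Finset.erase_eq_of_notMem (by simpa using he)]
  rw [h1]
  calc ∑ e ∈ univ \ X, hh ends lam X e w ≤ ∑ e : E, hh ends lam X e w :=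
        Finset.sum_le_sum_of_subset_of_nonneg (by simp) fun e _ _ => hh_nonneg ends hlam X e w
    _ = ∑ e ∈ bd ends (comp ends X w), LL lam (comp ends X w) := by
        unfold hh bd
        rw [Finset.sum_filter]
    _ = (bd ends (comp ends X w)).card * LL lam (comp ends X w) := by simp
    _ ≤ _ := by
        apply mul_le_mul_of_nonneg_left (LL_le_pow hlam hL _) (by positivity)

include hlam hL hL0 hL1 in
lemma theta_sum_step {X : Finset E} {f : E} (hf : f ∉ X) :
    ∑ e : E, (theta ends lam X e - theta ends lam (insert f X) e) ≤ 2 / (1 - L) +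
      if (ends f).2 ∈ comp ends X (ends f).1 then 0 else
        ((bd ends (comp ends X (ends f).1)).card * L ^ (comp ends X (ends f).1).card +
        (bd ends (comp ends X (ends f).2)).card * L ^ (comp ends X (ends f).2).card) := by
  have hb : ∀ e : E, theta ends lam X e - theta ends lam (insert f X) e ≤
      if (ends f).2 ∈ comp ends (X.erase e) (ends f).1 then 0 else
        hh ends lam (X.erase e) e (ends f).1 + hh ends lam (X.erase e) e (ends f).2 := by
    intro e
    by_cases hef : e = f
    · subst hef
      have : theta ends lam X e - theta ends lam (insert e X) e = 0 := by
        unfold theta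
        rw [Finset.erase_insert hf, Finset.erase_eq_of_notMem hf]; simp
      rw [this]
      split_ifs
      · exact le_rfl
      · exact add_nonneg (hh_nonneg ends hlam _ _ _) (hh_nonneg ends hlam _ _ _)
    · exact theta_diff ends hlam hef
  refine (Finset.sum_le_sum fun e _ => hb e).trans ?_
  rw [← Finset.sum_sdiff (Finset.subset_univ X), add_comm]
  apply add_le_add
  · calc _ ≤ ∑ e ∈ X, (hh ends lam (X.erase e) e (ends f).1 +
            hh ends lam (X.erase e) e (ends f).2) := by
          apply Finset.sum_le_sum
          intro e _
          split_ifs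
          · exact add_nonneg (hh_nonneg ends hlam _ _ _) (hh_nonneg ends hlam _ _ _)
          · exact le_rfl
      _ ≤ _ := by
          rw [Finset.sum_add_distrib]
          have h1 := hh_sum_in ends hlam hL hL0 hL1 X (ends f).1
          have h2 := hh_sum_in ends hlam hL hL0 hL1 X (ends f).2
          have : 2 / (1 - L) = 1 / (1 - L) + 1 / (1 - L) := by ring
          linarith
  · by_cases hc : (ends f).2 ∈ comp ends X (ends f).1
    · rw [if_pos hc]
      apply le_of_eq
      apply Finset.sum_eq_zero
      intro e he
      rw [Finset.erase_eq_of_notMem (by simpa using he), if_pos hc]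
    · rw [if_neg hc]
      calc _ ≤ ∑ e ∈ univ \ X, (hh ends lam (X.erase e) e (ends f).1 +
            hh ends lam (X.erase e) e (ends f).2) := by
            apply Finset.sum_le_sum
            intro e _
            split_ifs
            · exact add_nonneg (hh_nonneg ends hlam _ _ _) (hh_nonneg ends hlam _ _ _)
            · exact le_rfl
        _ ≤ _ := by
            rw [Finset.sum_add_distrib]
            exact add_le_add (hh_sum_out ends hlam hL X _) (hh_sum_out ends hlam hL X _)

include hp hlam hδ hδ0 hL hL0 hL1 hδL

lemma marg_step {X : Finset E} {f : E} (hf : f ∉ X) :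
    ∑ e : E, (marg (rcProb ends p lam univ) (insert f X) e - marg (rcProb ends p lam univ) X e) ≤
      1 / 2 + (FF ends δ L X - FF ends δ L (insert f X)) := by
  have hsub := Finset.subset_insert f X
  have h1 : ∑ e : E, (marg (rcProb ends p lam univ) (insert f X) e -
      marg (rcProb ends p lam univ) X e) ≤
      δ * ∑ e : E, (theta ends lam X e - theta ends lam (insert f X) e) := by
    rw [Finset.mul_sum]
    apply Finset.sum_le_sum
    intro e _
    refine ((marg_diff ends hp hlam hsub e).2).trans ?_
    exact mul_le_mul_of_nonneg_right (hδ e) (sub_nonneg.2 (theta_anti ends hlam hsub e))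
  refine h1.trans ((mul_le_mul_of_nonneg_left
    (theta_sum_step ends hlam hL hL0 hL1 hf) hδ0).trans ?_)
  rw [mul_add]
  split_ifs with hc
  · have := FF_anti ends δ L hsub
    linarith
  · have h2 := FF_step ends δ L hc
    have h3 := le_wC ends δ L (comp ends X (ends f).1)
    have h4 := le_wC ends δ L (comp ends X (ends f).2)
    rw [mul_add]
    linarith

lemma marg_mono_sum {X : Finset E} (D : Finset E) (hD : Disjoint X D) :
    ∑ e : E, (marg (rcProb ends p lam univ) (X ∪ D) e - marg (rcProb ends p lam univ) X e) ≤
      (D.card : ℝ) / 2 + (FF ends δ L X - FF ends δ L (X ∪ D)) := by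
  induction D using Finset.induction_on with
  | empty => simp
  | insert f D hfD ih =>
    have hfX : f ∉ X := fun h => Finset.disjoint_left.1 hD h (Finset.mem_insert_self f D)
    have ih := ih (hD.mono_right (Finset.subset_insert f D))
    have hf : f ∉ X ∪ D := by simp [hfX, hfD]
    have hs := marg_step ends hp hlam hδ hδ0 hL hL0 hL1 hδL hf
    rw [Finset.union_insert, Finset.card_insert_of_notMem hfD]
    rw [Finset.sum_sub_distrib] at *
    push_cast
    linarith

lemma marg_contract (X Y : Finset E) :
    ∑ e : E, |marg (rcProb ends p lam univ) X e - marg (rcProb ends p lam univ) Y e| ≤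
      ((symmDiff X Y).card : ℝ) / 2 + FF ends δ L X + FF ends δ L Y := by
  have h1 := marg_mono_sum ends hp hlam hδ hδ0 hL hL0 hL1 hδL (X := X) (Y \ X)
    Finset.disjoint_sdiff
  have h2 := marg_mono_sum ends hp hlam hδ hδ0 hL hL0 hL1 hδL (X := Y) (X \ Y)
    Finset.disjoint_sdiff
  rw [Finset.union_sdiff_self_eq_union] at h1 h2
  rw [Finset.union_comm Y X] at h2
  have hcard : (symmDiff X Y).card = (X \ Y).card + (Y \ X).card := by
    rw [symmDiff_def, Finset.sup_eq_union, Finset.card_union_of_disjoint]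
    exact disjoint_sdiff_sdiff
  have h3 : ∑ e : E, |marg (rcProb ends p lam univ) X e - marg (rcProb ends p lam univ) Y e| ≤
      ∑ e : E, (marg (rcProb ends p lam univ) (X ∪ Y) e - marg (rcProb ends p lam univ) X e) +
      ∑ e : E, (marg (rcProb ends p lam univ) (X ∪ Y) e - marg (rcProb ends p lam univ) Y e) := by
    rw [← Finset.sum_add_distrib]
    apply Finset.sum_le_sum
    intro e _
    have a1 := (marg_diff ends hp hlam (Finset.subset_union_left (s₁ := X) (s₂ := Y)) e).1
    have a2 := (marg_diff ends hp hlam (Finset.subset_union_right (s₁ := X) (s₂ := Y)) e).1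
    rw [abs_le]
    constructor <;> linarith
  have h4 := FF_nonneg ends δ L (X ∪ Y)
  rw [hcard]
  push_cast
  linarith

end contraction

open MeasureTheory Finset Real
set_option linter.unusedSectionVars false

section process
variable {E : Type} [Fintype E] [DecidableEq E] (μ : Finset E → ℝ)

/-- single-site update of `B` at `e` with the threshold computed from `A`. -/
noncomputable def upd (e : E) (r : ℝ) (A B : Finset E) : Finset E :=
  if r < marg μ A e then insert e B else B.erase e

/-- the parallel simulation as a recursion in time -/
noncomputable def WS (g : E → Bool) : ℕ → (T : ℕ) → (Fin T → E) → (Fin T → ℝ) → Finset E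
  | 0, _, _, _ => toSet g
  | _ + 1, 0, _, _ => toSet g
  | t + 1, T + 1, es, rs =>
      upd μ (es (Fin.last T)) (rs (Fin.last T))
        (WS g t T (fun i => es i.castSucc) (fun i => rs i.castSucc))
        (WS g (t + 1) T (fun i => es i.castSucc) (fun i => rs i.castSucc))

/-- Glauber dynamics -/
noncomputable def ZS (z : Finset E) : (T : ℕ) → (Fin T → E) → (Fin T → ℝ) → Finset E
  | 0, _, _ => z
  | T + 1, es, rs =>
      upd μ (es (Fin.last T)) (rs (Fin.last T))
        (ZS z T (fun i => es i.castSucc) (fun i => rs i.castSucc))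
        (ZS z T (fun i => es i.castSucc) (fun i => rs i.castSucc))

omit [Fintype E] [DecidableEq E] in
lemma max_map_castSucc {T : ℕ} (s : Finset (Fin T)) :
    (s.map Fin.castSuccEmb).max = s.max.map Fin.castSucc := by
  induction s using Finset.induction_on with
  | empty => rfl
  | insert a s ha ih =>
    rw [Finset.map_insert, Finset.max_insert, Finset.max_insert, ih]
    have hm : Monotone (WithBot.map (Fin.castSucc : Fin T → Fin (T + 1))) :=
      WithBot.monotone_map_iff.2 (Fin.strictMono_castSucc.monotone)
    rw [hm.map_max]
    rfl

lemma recBot_map {T : ℕ} (a : Bool) (g : Fin (T + 1) → Bool) (x : WithBot (Fin T)) :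
    (WithBot.recBotCoe a g (x.map Fin.castSucc) : Bool) =
      WithBot.recBotCoe a (fun j => g j.castSucc) x := by
  cases x <;> rfl

lemma pred_castSucc {T : ℕ} (es : Fin (T + 1) → E) (i : Fin T) (f : E) :
    pred es i.castSucc f = (pred (fun j => es j.castSucc) i f).map Fin.castSucc := by
  unfold pred
  rw [← max_map_castSucc]
  congr 1
  ext j
  simp only [Finset.mem_filter, Finset.mem_univ, true_and, Finset.mem_map, Fin.castSuccEmb_apply]
  constructor
  · rintro ⟨h1, h2⟩
    refine ⟨j.castLT (by have := i.2; have : j.val < i.val := h1; omega), ⟨?_, ?_⟩, ?_⟩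
    · exact h1
    · simpa using h2
    · simp
  · rintro ⟨k, ⟨h1, h2⟩, rfl⟩
    exact ⟨by simpa using h1, h2⟩

lemma pred_last {T : ℕ} (es : Fin (T + 1) → E) (f : E) :
    pred es (Fin.last T) f = (jlast (fun j => es j.castSucc) f).map Fin.castSucc := by
  unfold pred jlast
  rw [← max_map_castSucc]
  congr 1
  ext j
  simp only [Finset.mem_filter, Finset.mem_univ, true_and, Finset.mem_map, Fin.castSuccEmb_apply]
  constructor
  · rintro ⟨h1, h2⟩
    refine ⟨j.castLT h1, ?_, ?_⟩
    · simpa using h2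
    · simp
  · rintro ⟨k, h2, rfl⟩
    exact ⟨Fin.castSucc_lt_last k, h2⟩

lemma jlast_succ {T : ℕ} (es : Fin (T + 1) → E) (f : E) :
    jlast es f = if es (Fin.last T) = f then ((Fin.last T : Fin (T + 1)) : WithBot (Fin (T + 1)))
      else (jlast (fun j => es j.castSucc) f).map Fin.castSucc := by
  split_ifs with h
  · unfold jlast
    apply le_antisymm
    · apply Finset.max_le
      intro j _
      exact WithBot.coe_le_coe.2 (Fin.le_last j)
    · apply Finset.le_max
      simp [h]
  · rw [← pred_last]
    unfold pred jlast
    congr 1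
    ext j
    simp only [Finset.mem_filter, Finset.mem_univ, true_and]
    constructor
    · intro hj
      refine ⟨lt_of_le_of_ne (Fin.le_last j) ?_, hj⟩
      rintro rfl
      exact h hj
    · exact fun hj => hj.2

lemma Yiter_castSucc {T : ℕ} (es : Fin (T + 1) → E) (Rs : Fin (T + 1) → ℝ) (X' : E → Bool) (t : ℕ) :
    ∀ i : Fin T, Yiter μ es Rs X' t i.castSucc =
      Yiter μ (fun j => es j.castSucc) (fun j => Rs j.castSucc) X' t i := by
  induction t with
  | zero => intro i; rfl
  | succ t ih =>
    intro i
    have : sigmaConf es X' (Yiter μ es Rs X' t) i.castSucc =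
        sigmaConf (fun j => es j.castSucc) X'
          (Yiter μ (fun j => es j.castSucc) (fun j => Rs j.castSucc) X' t) i := by
      unfold sigmaConf
      simp only [pred_castSucc, recBot_map, ih]
    simp only [Yiter, this]

lemma XALG_zero {T : ℕ} (es : Fin T → E) (Rs : Fin T → ℝ) (X' : E → Bool) :
    XALG μ es Rs X' 0 = toSet X' := by
  unfold XALG toSet
  congr 1
  ext f
  rcases h : jlast es f with _ | j
  · rfl
  · have : es j = f := by
      have := Finset.mem_of_max h
      simpa using this
    show Yiter μ es Rs X' 0 j = true ↔ _
    simp only [Yiter, this]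

lemma XALG_eq (X' : E → Bool) (t T : ℕ) : ∀ (es : Fin T → E) (Rs : Fin T → ℝ),
    XALG μ es Rs X' t = WS μ X' t T es Rs := by
  induction T generalizing t with
  | zero =>
    intro es Rs
    have : WS μ X' t 0 es Rs = toSet X' := by cases t <;> simp [WS]
    rw [this]
    unfold XALG toSet
    congr 1
  | succ T ih =>
    intro es Rs
    cases t with
    | zero => rw [XALG_zero]; simp [WS]
    | succ t =>
      rw [WS, ← ih, ← ih]
      set es' := fun i : Fin T => es i.castSucc with hes'
      set Rs' := fun i : Fin T => Rs i.castSucc with hRs'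
      have hsig : sigmaConf es X' (Yiter μ es Rs X' t) (Fin.last T) = XALG μ es' Rs' X' t := by
        unfold sigmaConf XALG
        simp only [pred_last, recBot_map, Yiter_castSucc]
        rfl
      ext f
      have hmem : f ∈ XALG μ es Rs X' (t + 1) ↔
          WithBot.recBotCoe (X' f) (fun j => Yiter μ es Rs X' (t + 1) j) (jlast es f) = true := by
        simp [XALG]
      have hmem' : f ∈ XALG μ es' Rs' X' (t + 1) ↔
          WithBot.recBotCoe (X' f) (fun j => Yiter μ es' Rs' X' (t + 1) j) (jlast es' f) = true := by
        simp [XALG]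
      rw [hmem, jlast_succ]
      by_cases hf : es (Fin.last T) = f
      · rw [if_pos hf]
        show Yiter μ es Rs X' (t + 1) (Fin.last T) = true ↔ _
        simp only [Yiter, hsig, upd]
        rw [hf]
        split_ifs <;> simp
      · rw [if_neg hf, recBot_map]
        simp only [Yiter_castSucc]
        rw [← hmem']
        unfold upd
        have hf' : f ≠ es (Fin.last T) := fun h => hf h.symm
        split_ifs <;> simp [hf']

end process

open MeasureTheory Finset Real
set_option linter.unusedSectionVars false

/-- uniform measure on `[0,1]` -/
noncomputable abbrev UU : Measure ℝ := volume.restrict (Set.Icc (0 : ℝ) 1)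

instance instUU : IsProbabilityMeasure UU := ⟨by simp [UU]⟩

lemma pi_succ_integral {T : ℕ} (G : (Fin T → ℝ) → ℝ → ℝ)
    (hG : Integrable (fun q : ℝ × (Fin T → ℝ) => G q.2 q.1)
      (UU.prod (Measure.pi fun _ : Fin T => UU))) :
    ∫ r, G (fun i => r i.castSucc) (r (Fin.last T)) ∂(Measure.pi fun _ : Fin (T + 1) => UU) =
      ∫ r', ∫ s, G r' s ∂UU ∂(Measure.pi fun _ : Fin T => UU) := by
  have h := measurePreserving_piFinSuccAbove (fun _ : Fin (T + 1) => UU) (Fin.last T)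
  rw [← integral_prod_symm _ hG]
  rw [← h.integral_comp (MeasurableEquiv.measurableEmbedding _)]
  congr 1
  ext r
  simp [MeasurableEquiv.piFinSuccAbove, Fin.insertNthEquiv]
  rfl

lemma UU_ite {a : ℝ} (h0 : 0 ≤ a) (h1 : a ≤ 1) (x y : ℝ) :
    ∫ s, (if s < a then x else y) ∂UU = a * x + (1 - a) * y := by
  have hv : UU.real (Set.Iio a) = a := by
    rw [Measure.real, Measure.restrict_apply measurableSet_Iio]
    have : Set.Iio a ∩ Set.Icc 0 1 = Set.Ico 0 a := by
      ext s; simp only [Set.mem_inter_iff, Set.mem_Iio, Set.mem_Icc, Set.mem_Ico]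
      constructor
      · rintro ⟨h, h', _⟩; exact ⟨h', h⟩
      · rintro ⟨h, h'⟩; exact ⟨h', h, by linarith⟩
    rw [this]
    simp [h0]
  have e : (fun s : ℝ => if s < a then x else y) =
      fun s => (Set.Iio a).indicator (fun _ => x - y) s + y := by
    ext s
    by_cases h : s < a <;> simp [h, Set.indicator]
  rw [e, integral_add, integral_indicator measurableSet_Iio]
  · simp only [integral_const, smul_eq_mul, measureReal_restrict_apply_univ, hv]
    have h1 : volume.real (Set.Icc (0 : ℝ) 1) = 1 := by simp
    rw [h1]
    ring
  · exact (integrable_const _).indicator measurableSet_Iio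
  · exact integrable_const _

section expectation
variable {E : Type} [Fintype E] [DecidableEq E] (μ : Finset E → ℝ)

local instance instMSF : MeasurableSpace (Finset E) := ⊤

local instance instDMSF : DiscreteMeasurableSpace (Finset E) := ⟨fun _ => trivial⟩

lemma measurable_upd (e : E) {α : Type} [MeasurableSpace α] {r : α → ℝ} {A B : α → Finset E}
    (hr : Measurable r) (hA : Measurable A) (hB : Measurable B) :
    Measurable fun x => upd μ e (r x) (A x) (B x) := by
  unfold upd
  have h1 : Measurable fun A : Finset E => marg μ A e := Measurable.of_discrete
  have h2 : Measurable fun B : Finset E => insert e B := Measurable.of_discrete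
  have h3 : Measurable fun B : Finset E => B.erase e := Measurable.of_discrete
  exact Measurable.ite (measurableSet_lt hr (h1.comp hA)) (h2.comp hB) (h3.comp hB)

lemma measurable_WS (g : E → Bool) (t T : ℕ) : ∀ es : Fin T → E,
    Measurable fun r : Fin T → ℝ => WS μ g t T es r := by
  induction T generalizing t with
  | zero =>
    intro es
    have : (fun r : Fin 0 → ℝ => WS μ g t 0 es r) = fun _ => toSet g := by
      ext1 r; cases t <;> simp [WS]
    rw [this]; exact measurable_const
  | succ T ih =>
    intro es
    cases t with
    | zero => simp only [WS]; exact measurable_const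
    | succ t =>
      simp only [WS]
      have hr : Measurable fun r : Fin (T + 1) → ℝ => (fun i : Fin T => r i.castSucc) := by
        fun_prop
      exact measurable_upd μ _ (measurable_pi_apply _) ((ih t _).comp hr) ((ih (t + 1) _).comp hr)

lemma measurable_ZS (z : Finset E) (T : ℕ) : ∀ es : Fin T → E,
    Measurable fun r : Fin T → ℝ => ZS μ z T es r := by
  induction T with
  | zero => intro es; simp only [ZS]; exact measurable_const
  | succ T ih =>
    intro es
    simp only [ZS]
    have hr : Measurable fun r : Fin (T + 1) → ℝ => (fun i : Fin T => r i.castSucc) := by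
      fun_prop
    exact measurable_upd μ _ (measurable_pi_apply _) ((ih _).comp hr) ((ih _).comp hr)

lemma integrable_phi {α : Type} [MeasurableSpace α] {P : Measure α} [IsFiniteMeasure P]
    {A B Z : α → Finset E} (hA : Measurable A) (hB : Measurable B) (hZ : Measurable Z)
    (φ : Finset E → Finset E → Finset E → ℝ) :
    Integrable (fun x => φ (A x) (B x) (Z x)) P := by
  have hm : Measurable fun q : Finset E × Finset E × Finset E => φ q.1 q.2.1 q.2.2 :=
    Measurable.of_discrete
  have hm' : Measurable fun x => φ (A x) (B x) (Z x) :=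
    hm.comp (hA.prodMk (hB.prodMk hZ))
  obtain ⟨C, hC⟩ : ∃ C, ∀ q : Finset E × Finset E × Finset E, ‖φ q.1 q.2.1 q.2.2‖ ≤ C := by
    obtain ⟨C, hC⟩ := (Set.finite_range
      fun q : Finset E × Finset E × Finset E => ‖φ q.1 q.2.1 q.2.2‖).bddAbove
    exact ⟨C, fun q => hC ⟨q, rfl⟩⟩
  exact Integrable.of_bound hm'.aestronglyMeasurable C
    (Filter.Eventually.of_forall fun x => hC (A x, B x, Z x))

/-- weight of the initial configuration -/
noncomputable def gw (g : E → Bool) : ℝ :=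
  ∏ f : E, if g f then marg μ Finset.univ f else 1 - marg μ Finset.univ f

/-- joint expectation of a function of two consecutive rounds and the Glauber dynamics -/
noncomputable def E3 (T t : ℕ) (φ : Finset E → Finset E → Finset E → ℝ) : ℝ :=
  ∑ es : Fin T → E, ∑ g : E → Bool, ∑ z : Finset E,
    ((Fintype.card E : ℝ)⁻¹ ^ T * gw μ g * μ z) *
      ∫ r, φ (WS μ g t T es r) (WS μ g (t + 1) T es r) (ZS μ z T es r)
        ∂(Measure.pi fun _ : Fin T => UU)

/-- one step of the dynamics -/
noncomputable def KK (φ : Finset E → Finset E → ℝ) (A B Z : Finset E) : ℝ :=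
  (Fintype.card E : ℝ)⁻¹ * ∑ e : E, ∫ s, φ (upd μ e s A B) (upd μ e s Z Z) ∂UU

lemma E3_succ (T t : ℕ) (φ : Finset E → Finset E → ℝ) :
    E3 μ (T + 1) (t + 1) (fun A _ Z => φ A Z) = E3 μ T t (KK μ φ) := by
  unfold E3 KK
  rw [← (Fin.snocEquiv (fun _ : Fin (T + 1) => E)).sum_comp, Fintype.sum_prod_type, Finset.sum_comm]
  apply Finset.sum_congr rfl
  intro es _
  rw [Finset.sum_comm]
  apply Finset.sum_congr rfl
  intro g _
  rw [Finset.sum_comm]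
  apply Finset.sum_congr rfl
  intro z _
  have hW1 := measurable_WS μ g t T es
  have hW2 := measurable_WS μ g (t + 1) T es
  have hZ := measurable_ZS μ z T es
  have key : ∀ e : E, ∫ r, φ (WS μ g (t + 1) (T + 1)
        (Fin.snocEquiv (fun _ : Fin (T + 1) => E) (e, es)) r)
      (ZS μ z (T + 1) (Fin.snocEquiv (fun _ : Fin (T + 1) => E) (e, es)) r)
      ∂(Measure.pi fun _ : Fin (T + 1) => UU) =
      ∫ r, ∫ s, φ (upd μ e s (WS μ g t T es r) (WS μ g (t + 1) T es r))
        (upd μ e s (ZS μ z T es r) (ZS μ z T es r)) ∂UU ∂(Measure.pi fun _ : Fin T => UU) := by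
    intro e
    rw [← pi_succ_integral (fun r s => φ (upd μ e s (WS μ g t T es r) (WS μ g (t + 1) T es r))
        (upd μ e s (ZS μ z T es r) (ZS μ z T es r)))]
    · congr 1
      ext r
      simp [WS, ZS, Fin.snocEquiv]
    · have m1 := measurable_upd μ e (measurable_fst (α := ℝ) (β := Fin T → ℝ))
        (hW1.comp measurable_snd) (hW2.comp measurable_snd)
      have m2 := measurable_upd μ e (measurable_fst (α := ℝ) (β := Fin T → ℝ))
        (hZ.comp measurable_snd) (hZ.comp measurable_snd)
      exact integrable_phi m1 m1 m2 (fun A _ Z => φ A Z)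
  simp only [key]
  rw [integral_const_mul, integral_finsetSum]
  · rw [Finset.mul_sum, Finset.mul_sum]
    apply Finset.sum_congr rfl
    intro e _
    ring
  · intro e _
    exact integrable_phi hW1 hW2 hZ (fun A B Z => ∫ s, φ (upd μ e s A B) (upd μ e s Z Z) ∂UU)

lemma E3_add (T t : ℕ) (φ ψ : Finset E → Finset E → Finset E → ℝ) :
    E3 μ T t (fun A B Z => φ A B Z + ψ A B Z) = E3 μ T t φ + E3 μ T t ψ := by
  unfold E3
  simp only [← Finset.sum_add_distrib]
  refine Finset.sum_congr rfl fun es _ => Finset.sum_congr rfl fun g _ =>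
    Finset.sum_congr rfl fun z _ => ?_
  have i := fun φ => integrable_phi (P := Measure.pi fun _ : Fin T => UU) (measurable_WS μ g t T es)
    (measurable_WS μ g (t + 1) T es) (measurable_ZS μ z T es) φ
  rw [integral_add (i φ) (i ψ)]
  ring

lemma E3_smul (T t : ℕ) (c : ℝ) (φ : Finset E → Finset E → Finset E → ℝ) :
    E3 μ T t (fun A B Z => c * φ A B Z) = c * E3 μ T t φ := by
  unfold E3
  simp only [Finset.mul_sum]
  refine Finset.sum_congr rfl fun es _ => Finset.sum_congr rfl fun g _ =>
    Finset.sum_congr rfl fun z _ => ?_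
  rw [integral_const_mul]
  ring

lemma E3_sum {ι : Type} (s : Finset ι) (T t : ℕ) (φ : ι → Finset E → Finset E → Finset E → ℝ) :
    E3 μ T t (fun A B Z => ∑ i ∈ s, φ i A B Z) = ∑ i ∈ s, E3 μ T t (φ i) := by
  classical
  induction s using Finset.induction_on with
  | empty => simp [E3]
  | insert a s ha ih =>
    simp only [Finset.sum_insert ha]
    rw [E3_add, ih]

variable (hμ : ∀ X, 0 < μ X) (hsum : ∑ X, μ X = 1)
  (hm0 : ∀ X e, 0 ≤ marg μ X e) (hm1 : ∀ X e, marg μ X e ≤ 1)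

include hm0 hm1 in
lemma gw_nonneg (g : E → Bool) : 0 ≤ gw μ g := by
  apply Finset.prod_nonneg
  intro f _
  split_ifs
  · exact hm0 _ _
  · linarith [hm1 univ f]

lemma gw_disjoint (F : Finset E) :
    ∑ g : E → Bool, gw μ g * (if Disjoint F (toSet g) then 1 else 0) =
      ∏ f ∈ F, (1 - marg μ univ f) := by
  have h1 : ∀ g : E → Bool, gw μ g * (if Disjoint F (toSet g) then 1 else 0) =
      ∏ f : E, (fun (f : E) (b : Bool) => if b then (if f ∈ F then 0 else marg μ univ f)
        else 1 - marg μ univ f) f (g f) := by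
    intro g
    by_cases h : Disjoint F (toSet g)
    · rw [if_pos h, mul_one, gw]
      apply Finset.prod_congr rfl
      intro f _
      by_cases hg : g f = true
      · have : f ∉ F := fun hf => Finset.disjoint_left.1 h hf (by simp [toSet, hg])
        simp [hg, this]
      · simp [hg]
    · rw [if_neg h, mul_zero]
      rw [Finset.not_disjoint_iff] at h
      obtain ⟨f, hf, hg⟩ := h
      symm
      apply Finset.prod_eq_zero (Finset.mem_univ f)
      simp only [toSet, Finset.mem_filter, Finset.mem_univ, true_and] at hg
      simp [hg, hf]
  rw [Finset.sum_congr rfl (fun g _ => h1 g)]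
  rw [← Fintype.prod_sum (fun (f : E) (b : Bool) => if b then (if f ∈ F then 0 else marg μ univ f)
        else 1 - marg μ univ f)]
  simp only [Fintype.sum_bool, if_true, Bool.false_eq_true, if_false]
  rw [← Finset.prod_subset (Finset.subset_univ F)]
  · apply Finset.prod_congr rfl
    intro f hf
    simp [hf]
  · intro f _ hf
    simp [hf]

lemma gw_sum : ∑ g : E → Bool, gw μ g = 1 := by
  have := gw_disjoint μ ∅
  simpa using this

include hμ hm0 hm1 in
lemma E3_mono (T t : ℕ) {φ ψ : Finset E → Finset E → Finset E → ℝ}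
    (h : ∀ A B Z, φ A B Z ≤ ψ A B Z) : E3 μ T t φ ≤ E3 μ T t ψ := by
  unfold E3
  refine Finset.sum_le_sum fun es _ => Finset.sum_le_sum fun g _ =>
    Finset.sum_le_sum fun z _ => ?_
  have i := fun φ => integrable_phi (P := Measure.pi fun _ : Fin T => UU) (measurable_WS μ g t T es)
    (measurable_WS μ g (t + 1) T es) (measurable_ZS μ z T es) φ
  apply mul_le_mul_of_nonneg_left
  · exact integral_mono (i φ) (i ψ) fun r => h _ _ _
  · have := gw_nonneg μ hm0 hm1 g
    have := (hμ z).le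
    positivity

include hsum in
/-- functions of the initial set only -/
lemma E3_init [Nonempty E] (T t : ℕ) (φ : Finset E → Finset E → Finset E → ℝ) (c : (E → Bool) → ℝ)
    (h : ∀ es r g z, φ (WS μ g t T es r) (WS μ g (t + 1) T es r) (ZS μ z T es r) = c g) :
    E3 μ T t φ = ∑ g, gw μ g * c g := by
  unfold E3
  have hc : (Fintype.card E : ℝ) ≠ 0 := by
    have := Fintype.card_pos (α := E)
    positivity
  simp only [h, integral_const, probReal_univ, smul_eq_mul, one_mul]
  have : ∀ (g : E → Bool), ∑ z : Finset E, (Fintype.card E : ℝ)⁻¹ ^ T * gw μ g * μ z * c g =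
      (Fintype.card E : ℝ)⁻¹ ^ T * (gw μ g * c g) := by
    intro g
    rw [← Finset.sum_mul, ← Finset.mul_sum, hsum]
    ring
  simp only [this, ← Finset.mul_sum]
  rw [Finset.sum_const, Finset.card_univ, nsmul_eq_mul, Fintype.card_fun, Fintype.card_fin]
  push_cast
  rw [← mul_assoc, ← mul_pow, inv_mul_cancel₀ hc]
  simp

end expectation

open MeasureTheory Finset Real
set_option linter.unusedSectionVars false

section abstractpart
variable {E : Type} [Fintype E] [DecidableEq E] [Nonempty E] (μ : Finset E → ℝ)

lemma E3_const (hsum : ∑ X, μ X = 1) (T t : ℕ) (c : ℝ) : E3 μ T t (fun _ _ _ => c) = c := by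
  rw [E3_init μ hsum T t _ (fun _ => c) (fun _ _ _ _ => rfl), ← Finset.sum_mul, gw_sum, one_mul]

lemma E3_shift (T t : ℕ) (φ : Finset E → Finset E → ℝ) :
    E3 μ T t (fun _ B Z => φ B Z) = E3 μ T (t + 1) (fun A _ Z => φ A Z) := rfl

lemma upd_int (hm0 : ∀ X e, 0 ≤ marg μ X e) (hm1 : ∀ X e, marg μ X e ≤ 1) (e : E)
    (ψ : Finset E → ℝ) (A B : Finset E) :
    ∫ s, ψ (upd μ e s A B) ∂UU =
      marg μ A e * ψ (insert e B) + (1 - marg μ A e) * ψ (B.erase e) := by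
  rw [← UU_ite (hm0 _ _) (hm1 _ _)]
  congr 1
  ext s
  unfold upd
  split_ifs <;> rfl

lemma sum_pair (e : E) (f : Finset E → ℝ) :
    ∑ X, f X = ∑ X ∈ (univ.erase e).powerset, (f X + f (insert e X)) := by
  have h := Finset.sum_powerset_insert (Finset.notMem_erase e (univ : Finset E)) f
  rw [Finset.insert_erase (Finset.mem_univ e), Finset.powerset_univ] at h
  rw [h, Finset.sum_add_distrib]

lemma notMem_of_pair {e : E} {X : Finset E} (h : X ∈ (univ.erase e).powerset) : e ∉ X := by
  intro hx
  have := Finset.mem_powerset.1 h hx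
  simp at this

lemma detailed_balance (hμ : ∀ X, 0 < μ X) (e : E) (ψ : Finset E → ℝ) :
    ∑ Z, μ Z * (marg μ Z e * ψ (insert e Z) + (1 - marg μ Z e) * ψ (Z.erase e)) =
      ∑ Z, μ Z * ψ Z := by
  rw [sum_pair e, sum_pair e]
  apply Finset.sum_congr rfl
  intro X hX
  have hX := notMem_of_pair hX
  have h1 := hμ X
  have h2 := hμ (insert e X)
  have hne : μ (insert e X) + μ X ≠ 0 := by positivity
  simp only [marg, Finset.insert_idem, Finset.erase_insert hX, Finset.erase_eq_of_notMem hX]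
  field_simp
  ring

lemma E3_stationary (hμ : ∀ X, 0 < μ X) (hsum : ∑ X, μ X = 1)
    (hm0 : ∀ X e, 0 ≤ marg μ X e) (hm1 : ∀ X e, marg μ X e ≤ 1) (T : ℕ) :
    ∀ (t : ℕ) (ψ : Finset E → ℝ), E3 μ T t (fun _ _ Z => ψ Z) = ∑ X, μ X * ψ X := by
  induction T with
  | zero =>
    intro t ψ
    unfold E3
    simp only [ZS, integral_const, probReal_univ, smul_eq_mul, one_mul, pow_zero]
    simp only [Fintype.sum_unique, mul_assoc, ← Finset.mul_sum]
    rw [← Finset.sum_mul, gw_sum, one_mul]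
  | succ T ih =>
    intro t ψ
    have h0 : E3 μ (T + 1) t (fun _ _ Z => ψ Z) = E3 μ (T + 1) (0 + 1) (fun _ _ Z => ψ Z) := rfl
    rw [h0, E3_succ μ T 0 (fun _ Z => ψ Z)]
    unfold KK
    simp only [upd_int μ hm0 hm1]
    rw [ih 0 (fun Z => (Fintype.card E : ℝ)⁻¹ *
      ∑ e, (marg μ Z e * ψ (insert e Z) + (1 - marg μ Z e) * ψ (Z.erase e)))]
    have : ∀ Z, μ Z * ((Fintype.card E : ℝ)⁻¹ *
      ∑ e, (marg μ Z e * ψ (insert e Z) + (1 - marg μ Z e) * ψ (Z.erase e))) =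
      (Fintype.card E : ℝ)⁻¹ * ∑ e, μ Z *
        (marg μ Z e * ψ (insert e Z) + (1 - marg μ Z e) * ψ (Z.erase e)) := by
      intro Z
      rw [← Finset.mul_sum]; ring
    simp only [this]
    rw [← Finset.mul_sum, Finset.sum_comm]
    simp only [detailed_balance μ hμ]
    rw [Finset.sum_const, Finset.card_univ, nsmul_eq_mul, ← mul_assoc, inv_mul_cancel₀, one_mul]
    have := Fintype.card_pos (α := E)
    positivity

lemma mu_disjoint (hμ : ∀ X, 0 < μ X) (hsum : ∑ X, μ X = 1) {κ : ℝ} (hκ0 : 0 ≤ κ)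
    (hκ : ∀ X e, 1 - marg μ X e ≤ κ) (F : Finset E) :
    ∑ X, μ X * (if Disjoint F X then 1 else 0) ≤ κ ^ F.card := by
  induction F using Finset.induction_on with
  | empty => simp [hsum]
  | insert e F he ih =>
    rw [Finset.card_insert_of_notMem he, pow_succ']
    refine le_trans ?_ (mul_le_mul_of_nonneg_left ih hκ0)
    rw [sum_pair e, sum_pair e, Finset.mul_sum]
    apply Finset.sum_le_sum
    intro X hX
    have hX := notMem_of_pair hX
    have h1 := hμ X
    have h2 := hμ (insert e X)
    have h3 := hκ X e
    have hne : 0 < μ (insert e X) + μ X := by positivity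
    simp only [marg, Finset.erase_eq_of_notMem hX] at h3
    have h4 : μ X ≤ κ * (μ (insert e X) + μ X) := by
      rw [← div_le_iff₀ hne]
      refine le_trans (le_of_eq ?_) h3
      field_simp
      ring
    have d1 : Disjoint (insert e F) (insert e X) ↔ False := by
      simp
    have d2 : Disjoint (insert e F) X ↔ Disjoint F X := by
      simp [hX]
    have d3 : Disjoint F (insert e X) ↔ Disjoint F X := by
      simp [he]
    simp only [d1, d2, d3]
    by_cases hd : Disjoint F X
    · simp only [hd, if_true, if_false]
      linarith
    · simp only [hd, if_false]
      linarith

lemma W_disjoint (hμ : ∀ X, 0 < μ X) (hsum : ∑ X, μ X = 1)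
    (hm0 : ∀ X e, 0 ≤ marg μ X e) (hm1 : ∀ X e, marg μ X e ≤ 1) {κ : ℝ} (hκ0 : 0 ≤ κ)
    (hκ : ∀ X e, 1 - marg μ X e ≤ κ) (T : ℕ) :
    ∀ (t : ℕ) (F : Finset E),
      E3 μ T t (fun A _ _ => if Disjoint F A then 1 else 0) ≤ κ ^ F.card := by
  have hinit : ∀ F : Finset E, ∑ g : E → Bool, gw μ g * (if Disjoint F (toSet g) then 1 else 0) ≤
      κ ^ F.card := by
    intro F
    rw [gw_disjoint, ← Finset.prod_const]
    apply Finset.prod_le_prod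
    · intro e _; linarith [hm1 univ e]
    · intro e _; exact hκ _ _
  induction T with
  | zero =>
    intro t F
    rw [E3_init μ hsum 0 t _ (fun g => if Disjoint F (toSet g) then 1 else 0)]
    · exact hinit F
    · intro es r g z
      have hw : WS μ g t 0 es r = toSet g := by cases t <;> simp [WS]
      show (if Disjoint F (WS μ g t 0 es r) then (1 : ℝ) else 0) = _
      rw [hw]
  | succ T ih =>
    intro t F
    cases t with
    | zero =>
      rw [E3_init μ hsum (T + 1) 0 _ (fun g => if Disjoint F (toSet g) then 1 else 0)]
      · exact hinit F
      · intro es r g z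
        have hw : WS μ g 0 (T + 1) es r = toSet g := by simp [WS]
        show (if Disjoint F (WS μ g 0 (T + 1) es r) then (1 : ℝ) else 0) = _
        rw [hw]
    | succ t =>
      rw [E3_succ μ T t (fun A _ => if Disjoint F A then 1 else 0)]
      have hc : 0 < (Fintype.card E : ℝ) := by
        have := Fintype.card_pos (α := E)
        positivity
      have hle : ∀ A B Z, KK μ (fun A _ => if Disjoint F A then (1 : ℝ) else 0) A B Z ≤
          (Fintype.card E : ℝ)⁻¹ * ∑ e, (if e ∈ F then κ else 1) *
            (if Disjoint (F.erase e) B then (1 : ℝ) else 0) := by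
        intro A B Z
        unfold KK
        apply mul_le_mul_of_nonneg_left _ (by positivity)
        apply Finset.sum_le_sum
        intro e _
        rw [upd_int μ hm0 hm1 e (fun A => if Disjoint F A then (1 : ℝ) else 0)]
        have := hm0 A e
        have := hm1 A e
        have h3 := hκ A e
        by_cases he : e ∈ F
        · have d1 : Disjoint F (insert e B) ↔ False := by simp [he]
          have d2 : Disjoint F (B.erase e) ↔ Disjoint (F.erase e) B := Finset.disjoint_erase_comm.symm
          simp only [d1, d2, he, if_true, if_false]
          split_ifs <;> linarith
        · have d1 : Disjoint F (insert e B) ↔ Disjoint F B := by simp [he]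
          have d2 : Disjoint F (B.erase e) ↔ Disjoint F B := by
            rw [← Finset.disjoint_erase_comm, Finset.erase_eq_of_notMem he]
          simp only [d1, d2, he, if_false, Finset.erase_eq_of_notMem he]
          split_ifs <;> linarith
      refine (E3_mono μ hμ hm0 hm1 T t hle).trans ?_
      rw [E3_smul μ T t _ (fun _ B _ => ∑ e, (if e ∈ F then κ else 1) *
            (if Disjoint (F.erase e) B then (1 : ℝ) else 0)),
        E3_sum μ univ T t (fun e _ B _ => (if e ∈ F then κ else 1) *
            (if Disjoint (F.erase e) B then (1 : ℝ) else 0))]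
      have hb : ∀ e : E, E3 μ T t (fun _ B _ => (if e ∈ F then κ else 1) *
            (if Disjoint (F.erase e) B then (1 : ℝ) else 0)) ≤ κ ^ F.card := by
        intro e
        rw [E3_smul μ T t _ (fun _ B _ => (if Disjoint (F.erase e) B then (1 : ℝ) else 0)),
          E3_shift μ T t (fun B _ => (if Disjoint (F.erase e) B then (1 : ℝ) else 0))]
        have := ih (t + 1) (F.erase e)
        by_cases he : e ∈ F
        · rw [if_pos he, ← Finset.card_erase_add_one he, pow_succ']
          exact mul_le_mul_of_nonneg_left this hκ0
        · rw [if_neg he, one_mul]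
          rwa [Finset.erase_eq_of_notMem he] at this ⊢
      calc _ ≤ (Fintype.card E : ℝ)⁻¹ * ∑ _e : E, κ ^ F.card :=
            mul_le_mul_of_nonneg_left (Finset.sum_le_sum fun e _ => hb e) (by positivity)
        _ = κ ^ F.card := by
          rw [Finset.sum_const, Finset.card_univ, nsmul_eq_mul]
          field_simp

lemma integrable_ite (a x y : ℝ) : Integrable (fun s : ℝ => if s < a then x else y) UU := by
  refine Integrable.of_bound (C := |x| + |y|) ?_ ?_
  · exact (Measurable.ite measurableSet_Iio measurable_const measurable_const).aestronglyMeasurable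
  · refine Filter.Eventually.of_forall fun s => ?_
    show |_| ≤ _
    split_ifs
    · linarith [abs_nonneg y]
    · linarith [abs_nonneg x]

lemma symm_int (hm0 : ∀ X e, 0 ≤ marg μ X e) (hm1 : ∀ X e, marg μ X e ≤ 1) (e : E)
    (A B Z : Finset E) :
    ∫ s, ((symmDiff (upd μ e s A B) (upd μ e s Z Z)).card : ℝ) ∂UU =
      ((symmDiff B Z).erase e).card + |marg μ A e - marg μ Z e| := by
  have s1 : symmDiff (insert e B) (insert e Z) = (symmDiff B Z).erase e := by
    ext x; simp only [Finset.mem_symmDiff, Finset.mem_insert, Finset.mem_erase]; tauto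
  have s2 : symmDiff (B.erase e) (Z.erase e) = (symmDiff B Z).erase e := by
    ext x; simp only [Finset.mem_symmDiff, Finset.mem_erase]; tauto
  have s3 : symmDiff (insert e B) (Z.erase e) = insert e ((symmDiff B Z).erase e) := by
    ext x; simp only [Finset.mem_symmDiff, Finset.mem_insert, Finset.mem_erase]; tauto
  have s4 : symmDiff (B.erase e) (insert e Z) = insert e ((symmDiff B Z).erase e) := by
    ext x; simp only [Finset.mem_symmDiff, Finset.mem_insert, Finset.mem_erase]; tauto
  have s5 : (insert e ((symmDiff B Z).erase e)).card = ((symmDiff B Z).erase e).card + 1 :=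
    Finset.card_insert_of_notMem (Finset.notMem_erase _ _)
  set c : ℝ := (((symmDiff B Z).erase e).card : ℝ) with hc
  set a := marg μ A e with ha
  set z := marg μ Z e with hz
  have ha0 : 0 ≤ a := hm0 _ _
  have ha1 : a ≤ 1 := hm1 _ _
  have hz0 : 0 ≤ z := hm0 _ _
  have hz1 : z ≤ 1 := hm1 _ _
  have hfun : ∀ s, ((symmDiff (upd μ e s A B) (upd μ e s Z Z)).card : ℝ) =
      (if s < max a z then c + 1 else c) - (if s < min a z then 1 else 0) := by
    intro s
    unfold upd
    rw [← ha, ← hz]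
    by_cases h1 : s < a <;> by_cases h2 : s < z <;>
      simp [h1, h2, s1, s2, s3, s4, s5, hc]
  simp only [hfun]
  rw [integral_sub (integrable_ite _ _ _) (integrable_ite _ _ _),
    UU_ite (le_max_of_le_left ha0) (max_le ha1 hz1), UU_ite (le_min ha0 hz0) (min_le_of_left_le ha1)]
  have : |a - z| = max a z - min a z := (max_sub_min_eq_abs' a z).symm
  rw [this]
  ring

lemma sum_erase_card (D : Finset E) :
    ∑ e, ((D.erase e).card : ℝ) = (Fintype.card E - 1 : ℝ) * D.card := by
  have : ∀ e, ((D.erase e).card : ℝ) = D.card - (if e ∈ D then 1 else 0) := by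
    intro e
    split_ifs with h
    · rw [← Finset.card_erase_add_one h]; push_cast; ring
    · rw [Finset.erase_eq_of_notMem h]; ring
  simp only [this]
  rw [Finset.sum_sub_distrib]
  simp
  ring

/-- main contraction estimate -/
lemma coupling_bound (hμ : ∀ X, 0 < μ X) (hsum : ∑ X, μ X = 1)
    (hm0 : ∀ X e, 0 ≤ marg μ X e) (hm1 : ∀ X e, marg μ X e ≤ 1) {κ : ℝ} (hκ0 : 0 ≤ κ)
    (hκ : ∀ X e, 1 - marg μ X e ≤ κ) {ι : Type} [Fintype ι] (b : ι → Finset E) (w : ι → ℝ)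
    (hw : ∀ C, 0 ≤ w C)
    (hcon : ∀ X Y, ∑ e, |marg μ X e - marg μ Y e| ≤ ((symmDiff X Y).card : ℝ) / 2 +
      (∑ C, if Disjoint (b C) X then w C else 0) + ∑ C, if Disjoint (b C) Y then w C else 0)
    (T : ℕ) : ∀ t : ℕ,
    E3 μ T t (fun A _ Z => ((symmDiff A Z).card : ℝ)) ≤
      Fintype.card E * (1 / 2) ^ t + Fintype.card E * (1 - 1 / (2 * Fintype.card E)) ^ T +
        2 * (2 * ∑ C, w C * κ ^ (b C).card) := by
  have hm1' : (1 : ℝ) ≤ Fintype.card E := by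
    exact_mod_cast Fintype.card_pos (α := E)
  have hS : 0 ≤ ∑ C, w C * κ ^ (b C).card :=
    Finset.sum_nonneg fun C _ => mul_nonneg (hw C) (by positivity)
  have hq : (0 : ℝ) ≤ 1 - 1 / (2 * Fintype.card E) := by
    rw [sub_nonneg, div_le_one (by positivity)]; linarith
  have htriv : ∀ T t, E3 μ T t (fun A _ Z => ((symmDiff A Z).card : ℝ)) ≤ Fintype.card E := by
    intro T t
    rw [← E3_const μ hsum T t (Fintype.card E : ℝ)]
    apply E3_mono μ hμ hm0 hm1
    intro A B Z
    exact_mod_cast Finset.card_le_univ _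
  have hFW : ∀ T t, E3 μ T t (fun A _ _ => ∑ C, if Disjoint (b C) A then w C else 0) ≤
      ∑ C, w C * κ ^ (b C).card := by
    intro T t
    rw [E3_sum μ univ T t (fun C A _ _ => if Disjoint (b C) A then w C else 0)]
    apply Finset.sum_le_sum
    intro C _
    have : (fun (A _ _ : Finset E) => if Disjoint (b C) A then w C else 0) =
        fun (A _ _ : Finset E) => w C * (if Disjoint (b C) A then 1 else 0) := by
      ext A _ _; simp
    rw [this, E3_smul μ T t _ (fun A _ _ => if Disjoint (b C) A then 1 else 0)]
    exact mul_le_mul_of_nonneg_left (W_disjoint μ hμ hsum hm0 hm1 hκ0 hκ T t (b C)) (hw C)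
  have hFZ : ∀ T t, E3 μ T t (fun _ _ Z => ∑ C, if Disjoint (b C) Z then w C else 0) ≤
      ∑ C, w C * κ ^ (b C).card := by
    intro T t
    rw [E3_sum μ univ T t (fun C _ _ Z => if Disjoint (b C) Z then w C else 0)]
    apply Finset.sum_le_sum
    intro C _
    have : (fun (_ _ A : Finset E) => if Disjoint (b C) A then w C else 0) =
        fun (_ _ A : Finset E) => w C * (if Disjoint (b C) A then 1 else 0) := by
      ext _ _ A; simp
    rw [this, E3_smul μ T t _ (fun _ _ A => if Disjoint (b C) A then 1 else 0),
      E3_stationary μ hμ hsum hm0 hm1 T t (fun A => if Disjoint (b C) A then 1 else 0)]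
    exact mul_le_mul_of_nonneg_left (mu_disjoint μ hμ hsum hκ0 hκ (b C)) (hw C)
  induction T with
  | zero =>
    intro t
    refine (htriv 0 t).trans ?_
    have : (0 : ℝ) ≤ Fintype.card E * (1 / 2) ^ t := by positivity
    simp only [pow_zero, mul_one]
    linarith
  | succ T ih =>
    intro t
    cases t with
    | zero =>
      refine (htriv (T + 1) 0).trans ?_
      have : (0 : ℝ) ≤ Fintype.card E * (1 - 1 / (2 * Fintype.card E)) ^ (T + 1) := by positivity
      simp only [pow_zero, mul_one]
      linarith
    | succ t =>
      rw [E3_succ μ T t (fun A Z => ((symmDiff A Z).card : ℝ))]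
      set m : ℝ := (Fintype.card E : ℝ) with hm
      set S := ∑ C, w C * κ ^ (b C).card with hSdef
      have hle : ∀ A B Z, KK μ (fun A Z => ((symmDiff A Z).card : ℝ)) A B Z ≤
          (1 - m⁻¹) * ((symmDiff B Z).card : ℝ) + ((m⁻¹ * (1 / 2)) * ((symmDiff A Z).card : ℝ) +
          (m⁻¹ * (∑ C, if Disjoint (b C) A then w C else 0) +
           m⁻¹ * (∑ C, if Disjoint (b C) Z then w C else 0))) := by
        intro A B Z
        unfold KK
        simp only [symm_int μ hm0 hm1]
        rw [Finset.sum_add_distrib, sum_erase_card]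
        have h := hcon A Z
        have h' := mul_le_mul_of_nonneg_left h (show 0 ≤ m⁻¹ by positivity)
        rw [← hm]
        have e1 : m⁻¹ * ((m - 1) * ((symmDiff B Z).card : ℝ)) =
            (1 - m⁻¹) * ((symmDiff B Z).card : ℝ) := by field_simp
        rw [mul_add, e1]
        linarith
      refine (E3_mono μ hμ hm0 hm1 T t hle).trans ?_
      rw [E3_add μ T t (fun _ B Z => (1 - m⁻¹) * ((symmDiff B Z).card : ℝ)),
        E3_add μ T t (fun A _ Z => (m⁻¹ * (1 / 2)) * ((symmDiff A Z).card : ℝ)),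
        E3_add μ T t (fun A _ _ => m⁻¹ * (∑ C, if Disjoint (b C) A then w C else 0)),
        E3_smul μ T t _ (fun _ B Z => ((symmDiff B Z).card : ℝ)),
        E3_smul μ T t _ (fun A _ Z => ((symmDiff A Z).card : ℝ)),
        E3_smul μ T t _ (fun A _ _ => (∑ C, if Disjoint (b C) A then w C else 0)),
        E3_smul μ T t _ (fun _ _ Z => (∑ C, if Disjoint (b C) Z then w C else 0)),
        E3_shift μ T t (fun B Z => ((symmDiff B Z).card : ℝ))]
      have i1 := ih (t + 1)
      have i2 := ih t
      have i3 := hFW T t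
      have i4 := hFZ T t
      have hmi : 0 ≤ m⁻¹ := by positivity
      have hmi1 : 0 ≤ 1 - m⁻¹ := by
        rw [sub_nonneg]; exact inv_le_one_of_one_le₀ hm1'
      have j1 := mul_le_mul_of_nonneg_left i1 hmi1
      have j2 := mul_le_mul_of_nonneg_left i2 (show 0 ≤ m⁻¹ * (1 / 2) by positivity)
      have j3 := mul_le_mul_of_nonneg_left i3 hmi
      have j4 := mul_le_mul_of_nonneg_left i4 hmi
      refine (add_le_add j1 (add_le_add j2 (add_le_add j3 j4))).trans (le_of_eq ?_)
      rw [pow_succ (1 - 1 / (2 * m)), pow_succ]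
      have hm0' : m ≠ 0 := by positivity
      generalize (1 - 1 / (2 * m)) ^ T = q
      field_simp
      ring

end abstractpart

open MeasureTheory Finset Real
set_option linter.unusedSectionVars false

section link
variable {E : Type} [Fintype E] [DecidableEq E] [Nonempty E] (μ : Finset E → ℝ)
attribute [local instance] instMSF instDMSF

lemma sim_prob [MeasurableSpace E] [MeasurableSingletonClass E] (hsum : ∑ X, μ X = 1)
    (hm0 : ∀ X e, 0 ≤ marg μ X e) (hm1 : ∀ X e, marg μ X e ≤ 1) (T t : ℕ) (a : Finset E) :
    (simMeasure μ T ((fun ω : (Fin T → E) × (Fin T → ℝ) × (E → Bool) =>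
          XALG μ ω.1 ω.2.1 ω.2.2 t) ⁻¹' {a})).toReal =
      E3 μ T t (fun A _ _ => if A = a then 1 else 0) := by
  simp only [XALG_eq]
  set S := ((fun ω : (Fin T → E) × (Fin T → ℝ) × (E → Bool) =>
          WS μ ω.2.2 t T ω.1 ω.2.1) ⁻¹' {a}) with hS
  have hSr : ∀ es g, MeasurableSet {r : Fin T → ℝ | WS μ g t T es r = a} := by
    intro es g
    exact measurable_WS μ g t T es (measurableSet_singleton a)
  have hSm : MeasurableSet S := by
    have : S = ⋃ es : Fin T → E, ⋃ g : E → Bool,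
        ({es} : Set (Fin T → E)) ×ˢ ({r : Fin T → ℝ | WS μ g t T es r = a} ×ˢ
          ({g} : Set (E → Bool))) := by
      ext ⟨es, r, g⟩
      simp [hS]
    rw [this]
    refine MeasurableSet.iUnion fun es => MeasurableSet.iUnion fun g => ?_
    exact (measurableSet_singleton es).prod ((hSr es g).prod (measurableSet_singleton g))
  have hmap : ∀ (es : Fin T → E) (g : E → Bool),
      ((Measure.pi (fun _ : Fin T => UU)).map (fun r => (es, r, g))) S =
        (Measure.pi (fun _ : Fin T => UU)) {r | WS μ g t T es r = a} := by
    intro es g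
    rw [Measure.map_apply (by fun_prop) hSm]
    rfl
  unfold simMeasure
  simp only [Measure.coe_finset_sum, Finset.sum_apply, Measure.smul_apply, smul_eq_mul]
  have hterm : ∀ (es : Fin T → E) (g : E → Bool),
      ((Fintype.card E : ENNReal)⁻¹ ^ T * ENNReal.ofReal
          (∏ f : E, if g f then marg μ Finset.univ f else 1 - marg μ Finset.univ f)) *
      ((Measure.pi (fun _ : Fin T => UU)).map (fun r => (es, r, g))) S =
      ENNReal.ofReal ((Fintype.card E : ℝ)⁻¹ ^ T * gw μ g *
        ∫ r, (if WS μ g t T es r = a then 1 else 0) ∂(Measure.pi fun _ : Fin T => UU)) := by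
    intro es g
    have hg := gw_nonneg μ hm0 hm1 g
    have hc : 0 < (Fintype.card E : ℝ) := by exact_mod_cast Fintype.card_pos (α := E)
    rw [hmap, ENNReal.ofReal_mul (by positivity), ENNReal.ofReal_mul (by positivity),
      ENNReal.ofReal_pow (by positivity), ENNReal.ofReal_inv_of_pos hc, ENNReal.ofReal_natCast]
    congr 1
    have hi : (fun r => if WS μ g t T es r = a then (1 : ℝ) else 0) =
        Set.indicator {r | WS μ g t T es r = a} 1 := by
      ext r; simp [Set.indicator]
    rw [hi, integral_indicator_one (hSr es g), ofReal_measureReal]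
  have hnn : ∀ (es : Fin T → E) (g : E → Bool), 0 ≤ ((Fintype.card E : ℝ)⁻¹ ^ T * gw μ g *
        ∫ r, (if WS μ g t T es r = a then (1 : ℝ) else 0) ∂(Measure.pi fun _ : Fin T => UU)) := by
    intro es g
    have hg := gw_nonneg μ hm0 hm1 g
    have : 0 ≤ ∫ r, (if WS μ g t T es r = a then (1 : ℝ) else 0) ∂(Measure.pi fun _ : Fin T => UU) := by
      apply integral_nonneg
      intro r
      show (0 : ℝ) ≤ if WS μ g t T es r = a then (1 : ℝ) else 0
      split_ifs <;> norm_num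
    positivity
  simp only [hterm]
  rw [Finset.sum_congr rfl fun es _ => (ENNReal.ofReal_sum_of_nonneg
    (fun g _ => hnn es g)).symm]
  rw [← ENNReal.ofReal_sum_of_nonneg (fun es _ => Finset.sum_nonneg fun g _ => hnn es g),
    ENNReal.toReal_ofReal (Finset.sum_nonneg fun es _ => Finset.sum_nonneg fun g _ => hnn es g)]
  unfold E3
  refine Finset.sum_congr rfl fun es _ => Finset.sum_congr rfl fun g _ => ?_
  rw [← Finset.sum_mul, ← Finset.mul_sum, hsum, mul_one]

lemma dTV_le [MeasurableSpace E] [MeasurableSingletonClass E] (hμ : ∀ X, 0 < μ X)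
    (hsum : ∑ X, μ X = 1)
    (hm0 : ∀ X e, 0 ≤ marg μ X e) (hm1 : ∀ X e, marg μ X e ≤ 1) (T t : ℕ) :
    dTVrvDist (simMeasure μ T) (fun ω : (Fin T → E) × (Fin T → ℝ) × (E → Bool) =>
          XALG μ ω.1 ω.2.1 ω.2.2 t) μ ≤
      E3 μ T t (fun A _ Z => ((symmDiff A Z).card : ℝ)) := by
  unfold dTVrvDist
  simp only [sim_prob μ hsum hm0 hm1]
  have hst : ∀ a, μ a = E3 μ T t (fun _ _ Z => if Z = a then 1 else 0) := by
    intro a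
    rw [E3_stationary μ hμ hsum hm0 hm1 T t (fun Z => if Z = a then 1 else 0)]
    simp
  have h1 : ∀ a, |E3 μ T t (fun A _ _ => if A = a then 1 else 0) - μ a| ≤
      E3 μ T t (fun A _ Z => if A = Z then 0 else
        (if A = a then 1 else 0) + (if Z = a then 1 else 0)) := by
    intro a
    rw [hst a, abs_le]
    constructor
    · rw [neg_le_sub_iff_le_add, ← E3_add]
      apply E3_mono μ hμ hm0 hm1
      intro A B Z
      split_ifs <;> simp_all
    · rw [sub_le_iff_le_add, ← E3_add]
      apply E3_mono μ hμ hm0 hm1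
      intro A B Z
      split_ifs <;> simp_all
  calc _ ≤ (1 / 2) * ∑ a, E3 μ T t (fun A _ Z => if A = Z then 0 else
        (if A = a then 1 else 0) + (if Z = a then 1 else 0)) := by
        apply mul_le_mul_of_nonneg_left _ (by norm_num)
        exact Finset.sum_le_sum fun a _ => h1 a
    _ = E3 μ T t (fun A _ Z => (1 / 2) * ∑ a, if A = Z then 0 else
        (if A = a then (1 : ℝ) else 0) + (if Z = a then 1 else 0)) := by
        rw [E3_smul μ T t (1 / 2) (fun A _ Z => ∑ a, if A = Z then 0 else
          (if A = a then (1 : ℝ) else 0) + (if Z = a then 1 else 0)),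
          E3_sum μ univ T t (fun a A _ Z => if A = Z then 0 else
          (if A = a then (1 : ℝ) else 0) + (if Z = a then 1 else 0))]
    _ ≤ _ := by
        apply E3_mono μ hμ hm0 hm1
        intro A B Z
        by_cases h : A = Z
        · simp [h]
        · simp only [h, if_false]
          rw [Finset.sum_add_distrib]
          simp only [Finset.sum_ite_eq, Finset.mem_univ, if_true]
          have : 1 ≤ (symmDiff A Z).card := by
            rw [Nat.one_le_iff_ne_zero, Ne, Finset.card_eq_zero]
            intro h'
            exact h (symmDiff_eq_bot.1 h')
          have : (1 : ℝ) ≤ (symmDiff A Z).card := by exact_mod_cast this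
          linarith

end link

open MeasureTheory Finset Real
set_option linter.unusedSectionVars false

lemma term_bound {δ L l : ℝ} {k s : ℕ} (h0 : 0 < δ) (h1 : δ ≤ 1) (hL0 : 0 ≤ L) (hL1 : L ≤ 1)
    (hκ : 2 * δ ≤ exp (-2)) (h27 : 27 * (δ * l) ≤ 1 - L) (hl : 0 ≤ l)
    (h : 1 / 8 < δ * (k * L ^ s)) :
    δ * (k * L ^ s) * (2 * δ) ^ k ≤ exp (-(1 / (8 * δ))) * exp (-l) ^ s := by
  have hLs : L ^ s ≤ exp (-((1 - L) * s)) := by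
    have : L ≤ exp (-(1 - L)) := by
      have := add_one_le_exp (-(1 - L)); linarith
    calc L ^ s ≤ exp (-(1 - L)) ^ s := pow_le_pow_left₀ hL0 this s
      _ = exp (-((1 - L) * s)) := by rw [← exp_nat_mul]; congr 1; ring
  have hLs1 : L ^ s ≤ 1 := pow_le_one₀ hL0 hL1
  have hk : 1 / (8 * δ) + s * l ≤ k := by
    have a1 : 1 / 8 < δ * (k * exp (-((1 - L) * s))) := by
      refine h.trans_le ?_
      gcongr
    have a2 : exp ((1 - L) * s) ≤ 8 * δ * k := by
      rw [exp_neg] at a1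
      have hp := exp_pos ((1 - L) * s)
      have : δ * (k * (exp ((1 - L) * s))⁻¹) = δ * k / exp ((1 - L) * s) := by
        field_simp
      rw [this, lt_div_iff₀ hp] at a1
      linarith
    have a3 := add_one_le_exp ((1 - L) * s)
    have a4 : 27 * (δ * l) * s ≤ (1 - L) * s :=
      mul_le_mul_of_nonneg_right h27 (Nat.cast_nonneg s)
    have a5 : 0 ≤ δ * l * s := by positivity
    have : 1 / (8 * δ) + s * l = (1 + 8 * δ * (s * l)) / (8 * δ) := by field_simp
    rw [this, div_le_iff₀ (by positivity)]
    nlinarith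
  have hle : δ * (k * L ^ s) ≤ exp k := by
    have : (k : ℝ) ≤ exp k := by linarith [add_one_le_exp (k : ℝ)]
    refine le_trans ?_ this
    have : δ * L ^ s ≤ 1 := mul_le_one₀ h1 (by positivity) hLs1
    calc δ * (k * L ^ s) = k * (δ * L ^ s) := by ring
      _ ≤ k * 1 := by gcongr
      _ = k := mul_one _
  have hpw : (2 * δ) ^ k ≤ exp (-2) ^ k := pow_le_pow_left₀ (by positivity) hκ k
  calc _ ≤ exp k * exp (-2) ^ k := by gcongr
    _ = exp (-k) := by rw [← exp_nat_mul, ← exp_add]; congr 1; ring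
    _ ≤ exp (-(1 / (8 * δ)) + s * (-l)) := by apply exp_le_exp.2; linarith
    _ = _ := by rw [exp_add, exp_nat_mul]

lemma sum_bound {V E : Type} [Fintype V] [DecidableEq V] [Fintype E] [DecidableEq E]
    (ends : E → V × V) {δ L ε : ℝ} (hn : 3 ≤ Fintype.card V) (hε0 : 0 < ε) (hε : ε ≤ 1 / 2)
    (h0 : 0 < δ) (h1 : δ ≤ 1) (hL0 : 0 ≤ L) (hL1 : L ≤ 1)
    (hκ : 2 * δ ≤ exp (-2)) (h27 : 27 * (δ * log (Fintype.card V)) ≤ 1 - L)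
    (hD : 8 + log (1 / ε) ≤ 1 / (8 * δ)) :
    ∑ C : Finset V, wC ends δ L C * (2 * δ) ^ (bd ends C).card ≤ ε / 8 := by
  have hnpos : 0 < (Fintype.card V : ℝ) := by
    have : 0 < Fintype.card V := by omega
    exact_mod_cast this
  have hl : 0 ≤ log (Fintype.card V) := by
    apply log_nonneg
    have : 1 ≤ Fintype.card V := by omega
    exact_mod_cast this
  have hterm : ∀ C : Finset V, wC ends δ L C * (2 * δ) ^ (bd ends C).card ≤
      exp (-(1 / (8 * δ))) * exp (-log (Fintype.card V)) ^ C.card := by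
    intro C
    unfold wC
    split_ifs with h
    · exact term_bound h0 h1 hL0 hL1 hκ h27 hl h
    · rw [zero_mul]; positivity
  refine (Finset.sum_le_sum fun C _ => hterm C).trans ?_
  rw [← Finset.mul_sum]
  have hs : ∑ C : Finset V, exp (-log (Fintype.card V)) ^ C.card =
      (exp (-log (Fintype.card V)) + 1) ^ Fintype.card V := by
    rw [← Fintype.sum_pow_mul_eq_add_pow]
    simp
  rw [hs, exp_neg (log _), exp_log hnpos]
  have h2 : ((Fintype.card V : ℝ)⁻¹ + 1) ^ Fintype.card V ≤ exp 1 := by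
    calc _ ≤ exp ((Fintype.card V : ℝ)⁻¹) ^ Fintype.card V :=
          pow_le_pow_left₀ (by positivity) (add_one_le_exp _) _
      _ = exp 1 := by
        rw [← exp_nat_mul, mul_inv_cancel₀ hnpos.ne']
  calc _ ≤ exp (-(1 / (8 * δ))) * exp 1 := by gcongr
    _ = exp (-(1 / (8 * δ)) + 1) := by rw [exp_add]
    _ ≤ exp (-log (1 / ε) - log 8) := by
      apply exp_le_exp.2
      have := log_le_sub_one_of_pos (show (0 : ℝ) < 8 by norm_num)
      linarith
    _ = ε / 8 := by
      rw [exp_sub, exp_neg, exp_log (by positivity), exp_log (by norm_num)]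
      simp

lemma GD_bound {m ε : ℝ} {T : ℕ} (hm : 1 ≤ m) (hε0 : 0 < ε)
    (hT : 2 * m * (log m + log (4 / ε)) ≤ T) : m * (1 - 1 / (2 * m)) ^ T ≤ ε / 4 := by
  have hm0 : 0 < m := by linarith
  have hq : 0 ≤ 1 - 1 / (2 * m) := by
    rw [sub_nonneg, div_le_one (by positivity)]; linarith
  have : (1 - 1 / (2 * m)) ^ T ≤ exp (-(log m + log (4 / ε))) := by
    calc _ ≤ exp (-(1 / (2 * m))) ^ T :=
          pow_le_pow_left₀ hq (by linarith [add_one_le_exp (-(1 / (2 * m)))]) T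
      _ = exp (-(T / (2 * m))) := by rw [← exp_nat_mul]; congr 1; ring
      _ ≤ _ := by
        apply exp_le_exp.2
        rw [neg_le_neg_iff, le_div_iff₀ (by positivity)]
        linarith
  calc _ ≤ m * exp (-(log m + log (4 / ε))) := by gcongr
    _ = ε / 4 := by
      rw [exp_neg, exp_add, exp_log hm0, exp_log (by positivity)]
      field_simp

lemma PA_bound {m ε : ℝ} {T t : ℕ} (hm : 1 ≤ m) (hε0 : 0 < ε) (hε : ε ≤ 1 / 2)
    (hT : 2 * m * (log m + log (4 / ε)) ≤ T) (ht : 3 * log (4 * T / ε) ≤ t) :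
    m * (1 / 2) ^ t ≤ ε / 4 := by
  have hm0 : 0 < m := by linarith
  have h4 : 1 ≤ log (4 / ε) := by
    rw [le_log_iff_exp_le (by positivity), le_div_iff₀ hε0]
    have := exp_one_lt_d9
    nlinarith [exp_pos 1]
  have hmT : m ≤ T := by
    have := log_nonneg hm
    nlinarith
  have hT0 : (0 : ℝ) < T := by linarith
  have hlog : 0 ≤ log (4 * T / ε) := by
    apply log_nonneg
    rw [le_div_iff₀ hε0]; linarith
  have : (1 / 2 : ℝ) ^ t ≤ exp (-log (4 * T / ε)) := by
    have h2 : (1 / 2 : ℝ) = exp (-log 2) := by rw [exp_neg, exp_log (by norm_num)]; norm_num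
    rw [h2, ← exp_nat_mul]
    apply exp_le_exp.2
    have := log_two_gt_d9
    have ht0 : (0 : ℝ) ≤ t := Nat.cast_nonneg t
    nlinarith
  calc _ ≤ m * exp (-log (4 * T / ε)) := by gcongr
    _ = m / T * (ε / 4) := by
      rw [exp_neg, exp_log (by positivity)]
      field_simp
    _ ≤ 1 * (ε / 4) := by
      gcongr
      rw [div_le_one hT0]; exact hmT
    _ = ε / 4 := one_mul _

/-- **Theorem 4.3 (accuracy of the parallel simulation at low temperature).** For a connected
graph on `n ≥ 3` vertices and `m` edges, `p ∈ (0,1)^E`, `λ ∈ [0,1)^V`, `ε ∈ (0,1/2]` with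
`(1-p_min)·log n ≤ min{e^{-40}·exp(-5·log(1/ε)/log n), (1-λ_max)/27}`, and any
`T^GD ≥ ⌈2m(log m + log(4/ε))⌉`, `T^PA ≥ ⌈3·log(4·T^GD/ε)⌉`, the output `X^ALG` of
the parallel simulation applied to `μ = μ^RC_{E,p,λ}` satisfies `d_TV(X^ALG, μ) ≤ ε`. -/
theorem parallel_sim_rc_accuracy {V E : Type} [Fintype V] [DecidableEq V] [Nonempty V]
    [Fintype E] [DecidableEq E] [Nonempty E]
    [MeasurableSpace E] [MeasurableSingletonClass E]
    (ends : E → V × V) (hconn : GraphConnected ends)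
    (hn : 3 ≤ Fintype.card V)
    (p : E → ℝ) (lam : V → ℝ)
    (hp : ∀ e, p e ∈ Set.Ioo (0 : ℝ) 1) (hlam : ∀ v, lam v ∈ Set.Ico (0 : ℝ) 1)
    (ε : ℝ) (hε : ε ∈ Set.Ioc (0 : ℝ) (1 / 2))
    (hlow : (1 - Finset.univ.inf' Finset.univ_nonempty p) * Real.log (Fintype.card V) ≤
      min (Real.exp (-40) *
            Real.exp (-(5 * Real.log (1 / ε)) / Real.log (Fintype.card V)))
          ((1 - Finset.univ.sup' Finset.univ_nonempty lam) / 27))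
    (TGD TPA : ℕ)
    (hTGD : Nat.ceil (2 * (Fintype.card E : ℝ) *
        (Real.log (Fintype.card E) + Real.log (4 / ε))) ≤ TGD)
    (hTPA : Nat.ceil (3 * Real.log (4 * (TGD : ℝ) / ε)) ≤ TPA) :
    dTVrvDist (simMeasure (rcProb ends p lam Finset.univ) TGD)
        (fun ω : (Fin TGD → E) × (Fin TGD → ℝ) × (E → Bool) =>
          XALG (rcProb ends p lam Finset.univ) ω.1 ω.2.1 ω.2.2 TPA)
        (rcProb ends p lam Finset.univ) ≤ ε := by
  obtain ⟨hε0, hε2⟩ := hε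
  have hT := Nat.ceil_le.1 hTGD
  have ht := Nat.ceil_le.1 hTPA
  have hlow1 := hlow.trans (min_le_left _ _)
  have hlow2 := hlow.trans (min_le_right _ _)
  clear hlow
  obtain ⟨v0, -, hv0⟩ := Finset.exists_mem_eq_sup' (Finset.univ_nonempty (α := V)) lam
  obtain ⟨e0, -, he0⟩ := Finset.exists_mem_eq_inf' (Finset.univ_nonempty (α := E)) p
  have hL : ∀ v, lam v ≤ Finset.univ.sup' Finset.univ_nonempty lam :=
    fun v => Finset.le_sup' lam (Finset.mem_univ v)
  have hδ : ∀ e, 1 - p e ≤ 1 - Finset.univ.inf' Finset.univ_nonempty p :=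
    fun e => by linarith [Finset.inf'_le p (Finset.mem_univ e)]
  have hL0 : 0 ≤ Finset.univ.sup' Finset.univ_nonempty lam := by rw [hv0]; exact (hlam v0).1
  have hL1 : Finset.univ.sup' Finset.univ_nonempty lam < 1 := by rw [hv0]; exact (hlam v0).2
  have hδ0 : 0 < 1 - Finset.univ.inf' Finset.univ_nonempty p := by
    rw [he0]; linarith [(hp e0).2]
  have hδ1 : 1 - Finset.univ.inf' Finset.univ_nonempty p ≤ 1 := by
    rw [he0]; linarith [(hp e0).1]
  clear hv0 he0
  generalize 1 - Finset.univ.inf' Finset.univ_nonempty p = δ at *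
  generalize Finset.univ.sup' Finset.univ_nonempty lam = L at *
  have hl1 : 1 ≤ log (Fintype.card V) := by
    have h3 : (3 : ℝ) ≤ Fintype.card V := by exact_mod_cast hn
    rw [le_log_iff_exp_le (by linarith)]
    linarith [exp_one_lt_d9]
  have hlε : 0 ≤ log (1 / ε) := by
    apply log_nonneg
    rw [le_div_iff₀ hε0]; linarith
  have h40 : (64 : ℝ) ≤ exp 40 := by
    have : exp (40 : ℝ) = exp 1 ^ 40 := by rw [← exp_nat_mul]; norm_num
    rw [this]
    have h2 : (2 : ℝ) ≤ exp 1 := by linarith [add_one_le_exp (1 : ℝ)]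
    calc (64 : ℝ) ≤ 2 ^ 40 := by norm_num
      _ ≤ _ := pow_le_pow_left₀ (by norm_num) h2 40
  have hD : 8 + log (1 / ε) ≤ 1 / (8 * δ) := by
    rw [neg_div, exp_neg, exp_neg] at hlow1
    have a1 := add_one_le_exp (5 * log (1 / ε) / log (Fintype.card V))
    have a2 : δ * log (Fintype.card V) * (exp 40 * exp (5 * log (1 / ε) / log (Fintype.card V))) ≤ 1 := by
      rw [← mul_inv, ← one_div, le_div_iff₀ (by positivity)] at hlow1
      exact hlow1
    have a3 : δ * log (Fintype.card V) * (64 * (5 * log (1 / ε) / log (Fintype.card V) + 1)) ≤ 1 := by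
      refine le_trans ?_ a2
      gcongr
    have a4 : δ * log (Fintype.card V) * (64 * (5 * log (1 / ε) / log (Fintype.card V) + 1)) =
        64 * δ * (5 * log (1 / ε) + log (Fintype.card V)) := by
      field_simp
    rw [a4] at a3
    rw [le_div_iff₀ (by positivity)]
    nlinarith [mul_nonneg hδ0.le hlε, mul_le_mul_of_nonneg_left hl1 hδ0.le]
  have hκ : 2 * δ ≤ exp (-2) := by
    have b1 : δ ≤ exp (-40) := by
      have : exp (-(5 * log (1 / ε)) / log (Fintype.card V)) ≤ 1 := by
        rw [exp_le_one_iff, neg_div]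
        have : 0 ≤ 5 * log (1 / ε) / log (Fintype.card V) := by positivity
        linarith
      calc δ ≤ δ * log (Fintype.card V) := le_mul_of_one_le_right hδ0.le hl1
        _ ≤ _ := hlow1
        _ ≤ exp (-40) * 1 := by gcongr
        _ = _ := mul_one _
    have b2 : (2 : ℝ) ≤ exp 38 := by linarith [add_one_le_exp (38 : ℝ)]
    calc 2 * δ ≤ exp 38 * exp (-40) := by gcongr
      _ = exp (-2) := by rw [← exp_add]; norm_num
  have h27 : 27 * (δ * log (Fintype.card V)) ≤ 1 - L := by linarith
  have hδL : δ * (2 / (1 - L)) ≤ 1 / 8 := by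
    have : 0 < 1 - L := by linarith
    rw [← mul_div_assoc, div_le_iff₀ this]
    nlinarith
  have hm1 : (1 : ℝ) ≤ Fintype.card E := by exact_mod_cast Fintype.card_pos (α := E)
  have hμ := rcProb_pos ends hp hlam
  have hsum := rcProb_sum ends hp hlam
  have hb := marg_bounds ends hp hlam hδ
  have hm0' : ∀ X e, 0 ≤ marg (rcProb ends p lam univ) X e := fun X e => (hb X e).1
  have hm1' : ∀ X e, marg (rcProb ends p lam univ) X e ≤ 1 := fun X e => (hb X e).2.1
  refine (dTV_le _ hμ hsum hm0' hm1' TGD TPA).trans ?_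
  refine (coupling_bound _ hμ hsum hm0' hm1' (κ := 2 * δ) (by positivity)
    (fun X e => (hb X e).2.2) (bd ends) (wC ends δ L) (fun C => wC_nonneg ends δ L C)
    (fun X Y => marg_contract ends hp hlam hδ hδ0.le hL hL0 hL1 hδL X Y) TGD TPA).trans ?_
  have c1 := GD_bound hm1 hε0 hT
  have c2 := PA_bound hm1 hε0 hε2 hT ht
  have c3 := sum_bound ends hn hε0 hε2 hδ0 hδ1 hL0 hL1.le hκ h27 hD
  linarith
end
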